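/- Let n be a positive integer, H = ℚ(ζ_n + ζ_n⁻¹) the maximal real subfield of ℚ(ζ_n), and ℓ an odd prime such that q ≡ 1 (mod ℓ) for some prime factor q of n. Assume there exists a real quadratic subfield K_2 ⊆ H such that the ℓ-class number of H is ℓ^m and the ℓ-class number of K_2 is ℓ^{m-1}. Assume further that for every pair of subfields F ⊆ K of H with K_2 ⊆ F, [K:F] = ℓ, the ℓ-class number of F equal to ℓ^{m-1} and the ℓ-class number of K equal to ℓ^m, the ℓ-part of ker(t_{F→K}) is either trivial or isomorphic to (ℤ/ℓℤ)^r for some positive integer r. Then r_{2,ℓ} ≤ r_{H,ℓ} ≤ 1 + r_{2,ℓ}, where r_{2,ℓ} and r_{H,ℓ} are the ℓ-ranks of the class groups of K_2 and H respectively. -/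

import Mathlib

open NumberField IntermediateField Module
open scoped nonZeroDivisors

noncomputable section

namespace PaperStmt

/-- `ζ_n = exp(2πi/n)`, a primitive `n`-th root of unity (for `n > 0`). -/
def zetaC (n : ℕ) : ℂ := Complex.exp (2 * (Real.pi : ℂ) * Complex.I / n)

/-- The maximal real subfield `ℚ(ζ_n + ζ_n⁻¹)` of the cyclotomic field `ℚ(ζ_n)`. -/
def realCyclo (n : ℕ) : IntermediateField ℚ ℂ := ℚ⟮zetaC n + (zetaC n)⁻¹⟯

lemma isIntegral_of_pow_eq_one {x : ℂ} {k : ℕ} (hk : k ≠ 0) (h : x ^ k = 1) :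
    IsIntegral ℚ x :=
  ⟨Polynomial.X ^ k - Polynomial.C 1, Polynomial.monic_X_pow_sub_C 1 hk, by
    simp [h]⟩

lemma zetaC_pow (n : ℕ) (hn : n ≠ 0) : zetaC n ^ n = 1 := by
  have hn' : (n : ℂ) ≠ 0 := Nat.cast_ne_zero.mpr hn
  rw [zetaC, ← Complex.exp_nat_mul, mul_comm ((n : ℂ)), div_mul_cancel₀ _ hn',
    Complex.exp_two_pi_mul_I]

lemma isIntegral_zetaC_add_inv (n : ℕ) : IsIntegral ℚ (zetaC n + (zetaC n)⁻¹) := by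
  rcases eq_or_ne n 0 with h | h
  · have h1 : zetaC 0 = 1 := by simp [zetaC]
    subst h
    rw [h1, inv_one]
    exact isIntegral_one.add isIntegral_one
  · exact (isIntegral_of_pow_eq_one h (zetaC_pow n h)).add
      (isIntegral_of_pow_eq_one h (by rw [inv_pow, zetaC_pow n h, inv_one]))

instance (n : ℕ) : FiniteDimensional ℚ (realCyclo n) :=
  IntermediateField.adjoin.finiteDimensional (isIntegral_zetaC_add_inv n)

instance (E : IntermediateField ℚ ℂ) [FiniteDimensional ℚ E] : NumberField E := ⟨⟩

/-- The `p`-part (`p`-primary component / `p`-Sylow subgroup) of a commutative group. -/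
def pPart (G : Type*) [CommGroup G] (p : ℕ) (hp : p.Prime) : Subgroup G :=
  haveI : Fact p.Prime := ⟨hp⟩
  CommGroup.primaryComponent G p

/-- The `p`-class number: the order of the `p`-part. -/
def pCard (G : Type*) [CommGroup G] (p : ℕ) (hp : p.Prime) : ℕ :=
  Nat.card (pPart G p hp)

/-- The `p`-rank: `dim_{F_p} (G_p / G_p^p)`, read off as the exponent of `p`
in the order of the elementary abelian group `G_p / G_p^p`. -/
def pRank (G : Type*) [CommGroup G] (p : ℕ) (hp : p.Prime) : ℕ :=
  (Nat.card
    (↥(pPart G p hp) ⧸ (powMonoidHom p : ↥(pPart G p hp) →* ↥(pPart G p hp)).range)).factorization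
    p

/-- `t` is the homomorphism of class groups induced by extension of ideals along `F ⊆ K`:
it sends the class of a nonzero ideal `I` of `𝓞 F` to the class of `I · 𝓞 K`. -/
def IsClassGroupExtHom {F K : IntermediateField ℚ ℂ} [NumberField F] [NumberField K]
    (hFK : F ≤ K) (t : ClassGroup (𝓞 F) →* ClassGroup (𝓞 K)) : Prop :=
  ∀ (I : (Ideal (𝓞 F))⁰) (J : (Ideal (𝓞 K))⁰),
    Ideal.map (RingOfIntegers.mapRingHom (IntermediateField.inclusion hFK))
        (I : Ideal (𝓞 F)) = (J : Ideal (𝓞 K)) →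
    t (ClassGroup.mk0 I) = ClassGroup.mk0 J


open Filter Topology IsDedekindDomain

section EulerProduct

/-- A nonzero prime ideal, viewed in the monoid of nonzero ideals. -/
def primeIdeal {K : Type*} [Field K] [NumberField K] (v : HeightOneSpectrum (𝓞 K)) : (Ideal (𝓞 K))⁰ :=
  ⟨v.asIdeal, mem_nonZeroDivisors_of_ne_zero v.ne_bot⟩

lemma primeIdeal_injective {K : Type*} [Field K] [NumberField K] :
    Function.Injective (primeIdeal (K := K)) := fun _ _ h =>
  HeightOneSpectrum.ext (congrArg Subtype.val h)

variable {K : Type*} [Field K] [NumberField K]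

lemma asIdeal_dvd_mul (v w : HeightOneSpectrum (𝓞 K)) (h : v ≠ w) (a : (Ideal (𝓞 K))⁰) :
    v.asIdeal ∣ (primeIdeal w * a : (Ideal (𝓞 K))⁰) ↔ v.asIdeal ∣ (a : Ideal (𝓞 K)) := by
  have hvw : ¬ v.asIdeal ∣ w.asIdeal := fun hd =>
    h (HeightOneSpectrum.ext
      ((w.isMaximal.eq_of_le v.isPrime.ne_top (Ideal.dvd_iff_le.mp hd)).symm))
  rw [Submonoid.coe_mul, v.prime.dvd_mul]
  exact or_iff_right hvw

lemma tendsto_tsum_mul_prod_one_sub (f : (Ideal (𝓞 K))⁰ →* ℂ) (hf : Summable fun a => ‖f a‖) :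
    Tendsto (fun P : Finset (HeightOneSpectrum (𝓞 K)) =>
      (∑' a, f a) * ∏ v ∈ P, (1 - f (primeIdeal v))) atTop (𝓝 1) := by
  classical
  let g : Finset (HeightOneSpectrum (𝓞 K)) → (Ideal (𝓞 K))⁰ → ℂ := fun P a =>
    if ∀ v ∈ P, ¬ v.asIdeal ∣ (a : Ideal (𝓞 K)) then f a else 0
  have hgle : ∀ P a, ‖g P a‖ ≤ ‖f a‖ := by
    intro P a
    by_cases h : ∀ v ∈ P, ¬ v.asIdeal ∣ (a : Ideal (𝓞 K))
    · exact (congrArg norm (if_pos h)).le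
    · exact (congrArg norm (if_neg h)).le.trans (by simp)
  have hgs : ∀ P, Summable (g P) := fun P =>
    Summable.of_norm_bounded hf (hgle P)
  have key : ∀ P, ∑' a, g P a = (∑' a, f a) * ∏ v ∈ P, (1 - f (primeIdeal v)) := by
    intro P
    induction P using Finset.induction_on with
    | empty => simp [g]
    | insert w P hw ih =>
      rw [Finset.prod_insert hw, mul_left_comm, ← ih, sub_mul, one_mul, ← tsum_mul_left]
      have hinj : Function.Injective (fun a : (Ideal (𝓞 K))⁰ => primeIdeal w * a) :=
        mul_right_injective _
      let k : (Ideal (𝓞 K))⁰ → ℂ := fun a => if w.asIdeal ∣ (a : Ideal (𝓞 K)) then g P a else 0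
      have hk : ∑' a, f (primeIdeal w) * g P a = ∑' a, k a := by
        rw [← hinj.tsum_eq (f := k)]
        · refine tsum_congr fun a => ?_
          have h1 : w.asIdeal ∣ ((primeIdeal w * a : (Ideal (𝓞 K))⁰) : Ideal (𝓞 K)) :=
            Dvd.intro _ rfl
          have h2 : (∀ v ∈ P, ¬ v.asIdeal ∣ ((primeIdeal w * a : (Ideal (𝓞 K))⁰) : Ideal (𝓞 K))) ↔
              ∀ v ∈ P, ¬ v.asIdeal ∣ (a : Ideal (𝓞 K)) := by
            refine forall₂_congr fun v hv => ?_
            rw [asIdeal_dvd_mul v w (fun e => hw (e ▸ hv))]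
          simp only [k, g, if_pos h1, h2, map_mul, mul_ite, mul_zero]
        · intro a ha
          have hd : w.asIdeal ∣ (a : Ideal (𝓞 K)) := by
            by_contra hd
            exact ha (if_neg hd)
          obtain ⟨c, hc⟩ := hd
          refine ⟨⟨c, mem_nonZeroDivisors_of_ne_zero ?_⟩, Subtype.ext hc.symm⟩
          rintro rfl
          exact nonZeroDivisors.coe_ne_zero a (by rw [hc, mul_zero])
      have hks : Summable k := Summable.of_norm_bounded hf fun a => by
        by_cases h : w.asIdeal ∣ (a : Ideal (𝓞 K))
        · simpa [k, h] using hgle P a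
        · simp [k, h]
      rw [hk, ← (hgs P).tsum_sub hks]
      refine tsum_congr fun a => ?_
      by_cases h : w.asIdeal ∣ (a : Ideal (𝓞 K)) <;> simp [g, k, h]
  simp_rw [← key]
  have h1 : ∑' a : (Ideal (𝓞 K))⁰, (if a = 1 then (1 : ℂ) else 0) = 1 := by simp
  rw [← h1]
  refine tendsto_tsum_of_dominated_convergence hf (fun a => ?_) (Eventually.of_forall hgle)
  by_cases ha : a = 1
  · subst ha
    refine tendsto_const_nhds.congr fun P => ?_
    have : ∀ v ∈ P, ¬ v.asIdeal ∣ ((1 : (Ideal (𝓞 K))⁰) : Ideal (𝓞 K)) := fun v _ h =>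
      v.prime.not_isUnit (isUnit_of_dvd_one h)
    simp only [g, if_pos this]
    simp
  · rw [if_neg ha]
    have hne : (a : Ideal (𝓞 K)) ≠ ⊤ := fun h => ha (Subtype.ext (h.trans Ideal.one_eq_top.symm))
    obtain ⟨m, hm, hle⟩ := Ideal.exists_le_maximal _ hne
    have hm0 : m ≠ ⊥ := fun h => nonZeroDivisors.coe_ne_zero a (le_bot_iff.mp (h ▸ hle))
    refine tendsto_const_nhds.congr' ?_
    filter_upwards [eventually_ge_atTop
      {(⟨m, hm.isPrime, hm0⟩ : HeightOneSpectrum (𝓞 K))}] with P hP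
    have : ¬ ∀ v ∈ P, ¬ v.asIdeal ∣ (a : Ideal (𝓞 K)) := fun h =>
      h ⟨m, hm.isPrime, hm0⟩ (hP (Finset.mem_singleton_self _)) (Ideal.dvd_iff_le.mpr hle)
    simp only [g, if_neg this]

lemma abs_log_norm_one_sub_add_re_le {z : ℂ} (hz : ‖z‖ ≤ 1 / 2) :
    |Real.log ‖1 - z‖ + z.re| ≤ ‖z‖ ^ 2 := by
  have h := Complex.norm_log_one_add_sub_self_le (z := -z) (by rw [norm_neg]; linarith)
  rw [norm_neg, ← sub_eq_add_neg, sub_neg_eq_add] at h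
  have h2 : (Complex.log (1 - z) + z).re = Real.log ‖1 - z‖ + z.re := by
    rw [Complex.add_re, Complex.log_re]
  rw [← h2]
  refine (Complex.abs_re_le_norm _).trans (h.trans ?_)
  have h3 : (1 - ‖z‖)⁻¹ ≤ 2 := by
    rw [inv_le_comm₀ (by linarith) two_pos]; linarith
  nlinarith [sq_nonneg ‖z‖]

lemma abs_log_norm_tsum_sub_re_le (f : (Ideal (𝓞 K))⁰ →* ℂ) (hf : Summable fun a => ‖f a‖)
    (hf2 : ∀ v, ‖f (primeIdeal v)‖ ≤ 1 / 2) :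
    (∑' a, f a) ≠ 0 ∧ |Real.log ‖∑' a, f a‖ - ∑' v, (f (primeIdeal v)).re| ≤
      ∑' v, ‖f (primeIdeal v)‖ ^ 2 := by
  have ht := tendsto_tsum_mul_prod_one_sub f hf
  have hL : (∑' a, f a) ≠ 0 := by
    intro h
    simp only [h, zero_mul] at ht
    exact zero_ne_one (tendsto_nhds_unique tendsto_const_nhds ht)
  refine ⟨hL, ?_⟩
  have hfv : Summable fun v => ‖f (primeIdeal v)‖ := hf.comp_injective primeIdeal_injective
  have hre : Summable fun v => (f (primeIdeal v)).re :=
    Summable.of_norm_bounded hfv fun v => Complex.abs_re_le_norm _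
  have hsq : Summable fun v => ‖f (primeIdeal v)‖ ^ 2 := by
    refine Summable.of_nonneg_of_le (fun _ => sq_nonneg _) (fun v => ?_) hfv
    nlinarith [hf2 v, norm_nonneg (f (primeIdeal v))]
  have hlog : Tendsto (fun P : Finset (HeightOneSpectrum (𝓞 K)) =>
      Real.log ‖∑' a, f a‖ + ∑ v ∈ P, Real.log ‖1 - f (primeIdeal v)‖) atTop (𝓝 0) := by
    have := (Real.continuousAt_log (x := ‖(1 : ℂ)‖) (by simp)).tendsto.comp ht.norm
    rw [norm_one, Real.log_one] at this
    refine this.congr fun P => ?_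
    have hne : ∀ v, 1 - f (primeIdeal v) ≠ 0 := fun v h => by
      have h2 := hf2 v
      rw [← sub_eq_zero.mp h, norm_one] at h2
      norm_num at h2
    rw [Function.comp_apply, norm_mul, norm_prod, Real.log_mul (norm_ne_zero_iff.mpr hL)
      (Finset.prod_ne_zero_iff.mpr fun v _ => norm_ne_zero_iff.mpr (hne v)),
      Real.log_prod (fun v _ => norm_ne_zero_iff.mpr (hne v))]
  have h2 : Tendsto (fun P : Finset (HeightOneSpectrum (𝓞 K)) =>
      |∑ v ∈ P, (Real.log ‖1 - f (primeIdeal v)‖ + (f (primeIdeal v)).re)|) atTop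
      (𝓝 |Real.log ‖∑' a, f a‖ - ∑' v, (f (primeIdeal v)).re|) := by
    rw [abs_sub_comm]
    refine Tendsto.abs ?_
    have h3 : Tendsto (fun P : Finset (HeightOneSpectrum (𝓞 K)) =>
      ∑ v ∈ P, (f (primeIdeal v)).re) atTop (𝓝 (∑' v, (f (primeIdeal v)).re)) := hre.hasSum
    have h4 := (hlog.add h3).sub_const (Real.log ‖∑' a, f a‖)
    rw [zero_add] at h4
    refine h4.congr fun P => ?_
    rw [Finset.sum_add_distrib]; ring
  refine le_of_tendsto h2 (Eventually.of_forall fun P => ?_)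
  refine (Finset.abs_sum_le_sum_abs _ _).trans ?_
  refine (Finset.sum_le_sum fun v _ => abs_log_norm_one_sub_add_re_le (hf2 v)).trans ?_
  exact hsq.sum_le_tsum _ fun _ _ => sq_nonneg _

end EulerProduct

section Dirichlet

lemma norm_dirichlet_mul_prime_cpow_le {n : ℕ} (ψ : DirichletCharacter ℂ n) (p : Nat.Primes)
    (s : ℝ) : ‖ψ p * (p : ℂ) ^ (-(s : ℂ))‖ ≤ (p : ℝ) ^ (-s) := by
  rw [norm_mul, Complex.norm_natCast_cpow_of_pos p.2.pos, Complex.neg_re, Complex.ofReal_re]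
  exact mul_le_of_le_one_left (by positivity) (ψ.norm_le_one _)

variable {n : ℕ} [NeZero n]

lemma prime_rpow_neg_le (p : Nat.Primes) {s : ℝ} (hs : 1 ≤ s) : (p : ℝ) ^ (-s) ≤ (p : ℝ)⁻¹ := by
  rw [← Real.rpow_neg_one]
  exact Real.rpow_le_rpow_of_exponent_le (by exact_mod_cast p.2.one_le) (by linarith)

lemma abs_log_norm_LFunction_sub_le (ψ : DirichletCharacter ℂ n) {s : ℝ} (hs : 1 < s) :
    |Real.log ‖ψ.LFunction s‖ - ∑' p : Nat.Primes, (ψ p * (p : ℂ) ^ (-(s : ℂ))).re| ≤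
      ∑' p : Nat.Primes, ((p : ℝ) ^ 2)⁻¹ := by
  have hs' : 1 < (s : ℂ).re := hs
  have hle : ∀ p : Nat.Primes, ‖ψ p * (p : ℂ) ^ (-(s : ℂ))‖ ≤ (p : ℝ)⁻¹ := fun p =>
    (norm_dirichlet_mul_prime_cpow_le ψ p s).trans (prime_rpow_neg_le p hs.le)
  have hhalf : ∀ p : Nat.Primes, ‖ψ p * (p : ℂ) ^ (-(s : ℂ))‖ ≤ 1 / 2 := fun p =>
    (hle p).trans (by
      rw [one_div]
      exact inv_anti₀ two_pos (by exact_mod_cast p.2.two_le))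
  have hsum : Summable fun p : Nat.Primes => ‖ψ p * (p : ℂ) ^ (-(s : ℂ))‖ :=
    Summable.of_nonneg_of_le (fun _ => norm_nonneg _)
      (fun p => norm_dirichlet_mul_prime_cpow_le ψ p s)
      ((Real.summable_nat_rpow.mpr (by linarith)).comp_injective Nat.Primes.coe_nat_injective)
  have hre : Summable fun p : Nat.Primes => (ψ p * (p : ℂ) ^ (-(s : ℂ))).re :=
    Summable.of_norm_bounded hsum fun v => Complex.abs_re_le_norm _
  have hlog := DirichletCharacter.summable_neg_log_one_sub_mul_prime_cpow ψ hs'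
  have hsq : Summable fun p : Nat.Primes => ((p : ℝ) ^ 2)⁻¹ :=
    (Real.summable_nat_pow_inv.mpr one_lt_two).comp_injective Nat.Primes.coe_nat_injective
  rw [DirichletCharacter.LFunction_eq_LSeries ψ hs',
    ← DirichletCharacter.LSeries_eulerProduct_exp_log ψ hs', Complex.norm_exp, Real.log_exp,
    Complex.re_tsum hlog, ← (Complex.hasSum_re hlog.hasSum).summable.tsum_sub hre]
  rw [← Real.norm_eq_abs]
  refine tsum_of_norm_bounded hsq.hasSum fun p => ?_
  rw [Complex.neg_re, Complex.log_re, Real.norm_eq_abs, ← abs_neg, neg_sub, sub_neg_eq_add,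
    add_comm]
  refine (abs_log_norm_one_sub_add_re_le (hhalf p)).trans ?_
  rw [← inv_pow]
  exact pow_le_pow_left₀ (norm_nonneg _) (hle p) 2

lemma exists_eventually_le_tsum_prime (ψ : DirichletCharacter ℂ n) [Decidable (ψ = 1)] :
    ∃ C : ℝ, ∀ᶠ s : ℝ in 𝓝[>] 1, (if ψ = 1 then -Real.log (s - 1) else 0) - C ≤
      ∑' p : Nat.Primes, (ψ p * (p : ℂ) ^ (-(s : ℂ))).re := by
  set B := ∑' p : Nat.Primes, ((p : ℝ) ^ 2)⁻¹
  suffices h : ∃ c : ℝ, Tendsto (fun s : ℝ => Real.log ‖ψ.LFunction s‖ -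
      (if ψ = 1 then -Real.log (s - 1) else 0)) (𝓝[>] 1) (𝓝 c) by
    obtain ⟨c, hc⟩ := h
    refine ⟨B + 1 - c, ?_⟩
    filter_upwards [hc.eventually_const_le (sub_one_lt c), self_mem_nhdsWithin] with s h1 h2
    have := (abs_le.mp (abs_log_norm_LFunction_sub_le ψ h2)).2
    linarith
  split_ifs with h
  · subst h
    have hlim := DirichletCharacter.LFunctionTrivChar_residue_one (N := n)
    have hne : (∏ p ∈ n.primeFactors, (1 - (p : ℂ)⁻¹)) ≠ 0 := by
      refine Finset.prod_ne_zero_iff.mpr fun p hp => ?_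
      have := (Nat.prime_of_mem_primeFactors hp).one_lt
      rw [sub_ne_zero]
      intro h
      rw [eq_comm, inv_eq_one] at h
      norm_cast at h
      omega
    have hmap : Tendsto (fun s : ℝ => (s : ℂ)) (𝓝[>] 1) (𝓝[≠] 1) := by
      refine tendsto_nhdsWithin_of_tendsto_nhds_of_eventually_within _ ?_ ?_
      · exact (Complex.continuous_ofReal.tendsto' 1 1 (by simp)).mono_left nhdsWithin_le_nhds
      · filter_upwards [self_mem_nhdsWithin] with s hs
        simpa using (ne_of_gt hs : s ≠ 1)
    have h2 := ((Real.continuousAt_log (norm_ne_zero_iff.mpr hne)).tendsto.comp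
      (hlim.comp hmap).norm)
    refine ⟨_, h2.congr' ?_⟩
    filter_upwards [self_mem_nhdsWithin] with s hs
    have hs1 : 0 < s - 1 := sub_pos.mpr hs
    have hL : (1 : DirichletCharacter ℂ n).LFunction s ≠ 0 :=
      DirichletCharacter.LFunction_ne_zero_of_one_le_re 1
        (Or.inr (by simpa using (ne_of_gt hs : s ≠ 1))) (by simpa using le_of_lt hs)
    have h3 : ‖((s : ℂ) - 1)‖ = s - 1 := by
      rw [← Complex.ofReal_one, ← Complex.ofReal_sub, Complex.norm_real, Real.norm_of_nonneg hs1.le]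
    simp only [Function.comp_apply, norm_mul, h3]
    rw [Real.log_mul hs1.ne' (norm_ne_zero_iff.mpr hL), sub_neg_eq_add, add_comm]
  · have hL := DirichletCharacter.LFunction_apply_one_ne_zero h
    have hc : Tendsto (fun s : ℝ => ψ.LFunction s) (𝓝[>] 1) (𝓝 (ψ.LFunction 1)) :=
      ((DirichletCharacter.differentiable_LFunction h).continuous.comp
        Complex.continuous_ofReal).tendsto' 1 _ (by simp) |>.mono_left nhdsWithin_le_nhds
    refine ⟨Real.log ‖ψ.LFunction 1‖, ?_⟩
    simp only [sub_zero]
    exact (Real.continuousAt_log (norm_ne_zero_iff.mpr hL)).tendsto.comp hc.norm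

open Classical in
lemma sum_mul_dirichlet_eq (T : Subgroup (ZMod n)ˣ) (b : ZMod n) :
    ∑ ψ : DirichletCharacter ℂ n, (if ∀ a ∈ T, ψ a = 1 then (Nat.card T : ℂ) else 0) * ψ b =
      if ∃ a ∈ T, (a : ZMod n) = b then (n.totient : ℂ) else 0 := by
  have h1 : ∀ ψ : DirichletCharacter ℂ n,
      (if ∀ a ∈ T, ψ a = 1 then (Nat.card T : ℂ) else 0) =
        ∑ a : T, ψ ((a : (ZMod n)ˣ)⁻¹ : (ZMod n)ˣ) := by
    intro ψ
    have h2 := sum_hom_units ((ψ : ZMod n →* ℂ).comp ((Units.coeHom (ZMod n)).comp T.subtype))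
    rw [← Equiv.sum_comp (Equiv.inv T)] at h2
    have h3 : ((ψ : ZMod n →* ℂ).comp ((Units.coeHom (ZMod n)).comp T.subtype) = 1) ↔
        ∀ a ∈ T, ψ a = 1 := by
      constructor
      · intro h a ha
        exact DFunLike.congr_fun h ⟨a, ha⟩
      · intro h
        ext a
        exact h a a.2
    simp only [h3] at h2
    rw [Nat.card_eq_fintype_card]
    convert h2.symm using 2
    · simp
    · rfl
  simp_rw [h1, Finset.sum_mul]
  rw [Finset.sum_comm]
  have h4 : ∀ a : T, ∑ ψ : DirichletCharacter ℂ n, ψ ((a : (ZMod n)ˣ)⁻¹ : (ZMod n)ˣ) * ψ b =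
      if ((a : (ZMod n)ˣ) : ZMod n) = b then (n.totient : ℂ) else 0 := by
    intro a
    have := DirichletCharacter.sum_char_inv_mul_char_eq ℂ (a : (ZMod n)ˣ).isUnit b
    rw [← this]
    simp
  simp_rw [h4]
  split_ifs with h
  · obtain ⟨a, ha, rfl⟩ := h
    rw [Finset.sum_eq_single ⟨a, ha⟩]
    · simp
    · rintro ⟨b, hb⟩ - hne
      rw [if_neg]
      intro h
      exact hne (Subtype.ext (Units.ext h))
    · simp
  · refine Finset.sum_eq_zero fun a _ => if_neg fun ha => h ⟨a, a.2, ha⟩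

open Classical in
lemma exists_eventually_le_tsum_prime_mem (T : Subgroup (ZMod n)ˣ) :
    ∃ C : ℝ, ∀ᶠ s : ℝ in 𝓝[>] 1, (Nat.card T : ℝ) * -Real.log (s - 1) - C ≤
      n.totient * ∑' p : Nat.Primes,
        if ∃ a ∈ T, (a : ZMod n) = (p : ℕ) then (p : ℝ) ^ (-s) else 0 := by
  choose C hC using fun ψ : DirichletCharacter ℂ n => exists_eventually_le_tsum_prime ψ
  let c : DirichletCharacter ℂ n → ℝ := fun ψ => if ∀ a ∈ T, ψ a = 1 then (Nat.card T : ℝ) else 0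
  have hc0 : ∀ ψ, 0 ≤ c ψ := fun ψ => by
    simp only [c]; split_ifs <;> positivity
  refine ⟨∑ ψ, c ψ * C ψ, ?_⟩
  filter_upwards [eventually_all.mpr hC, self_mem_nhdsWithin] with s h1 h2
  have hs : 1 < s := h2
  have hsum : ∀ ψ : DirichletCharacter ℂ n,
      Summable fun p : Nat.Primes => (ψ p * (p : ℂ) ^ (-(s : ℂ))).re := fun ψ => by
    refine Summable.of_norm_bounded
      ((Real.summable_nat_rpow.mpr (show -s < -1 by linarith)).comp_injective
        Nat.Primes.coe_nat_injective) fun p => ?_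
    exact (Complex.abs_re_le_norm _).trans (norm_dirichlet_mul_prime_cpow_le ψ p s)
  have key : n.totient * ∑' p : Nat.Primes,
        (if ∃ a ∈ T, (a : ZMod n) = (p : ℕ) then (p : ℝ) ^ (-s) else 0) =
      ∑ ψ, c ψ * ∑' p : Nat.Primes, (ψ p * (p : ℂ) ^ (-(s : ℂ))).re := by
    simp_rw [← tsum_mul_left]
    rw [← Summable.tsum_finsetSum fun ψ _ => (hsum ψ).mul_left _]
    refine tsum_congr fun p => ?_
    have h5 := congrArg (fun z : ℂ => (z * ((p : ℝ) ^ (-s) : ℝ)).re) (sum_mul_dirichlet_eq T p)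
    have h6 : (((p : ℝ) ^ (-s) : ℝ) : ℂ) = (p : ℂ) ^ (-(s : ℂ)) := by
      rw [Complex.ofReal_cpow (by positivity)]; push_cast; rfl
    simp only [Finset.sum_mul, Complex.re_sum] at h5
    convert h5.symm using 1
    · split_ifs <;> simp [← Complex.ofReal_natCast, ← Complex.ofReal_mul]
    · refine Finset.sum_congr rfl fun ψ _ => ?_
      rw [← h6, mul_assoc, ← Complex.re_ofReal_mul]
      congr 2
      simp only [c]
      split_ifs <;> simp
  rw [key]
  have h7 : (Nat.card T : ℝ) * -Real.log (s - 1) =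
      ∑ ψ, c ψ * (if ψ = 1 then -Real.log (s - 1) else 0) := by
    rw [Finset.sum_eq_single 1]
    · have : c 1 = Nat.card T := if_pos fun a _ => by simp
      rw [this, if_pos rfl]
    · intro ψ _ h
      rw [if_neg h, mul_zero]
    · simp
  rw [h7, ← Finset.sum_sub_distrib]
  refine Finset.sum_le_sum fun ψ _ => ?_
  rw [← mul_sub]
  exact mul_le_mul_of_nonneg_left (h1 ψ) (hc0 ψ)

end Dirichlet

section NormSeries

lemma tsum_eq_sum_tsum_fiber {α β : Type*} [Fintype β] (g : α → β) {f : α → ℂ} (hf : Summable f) :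
    ∑' a, f a = ∑ b, ∑' a : {a // g a = b}, f a := by
  have h : Summable (f ∘ Equiv.sigmaFiberEquiv g) := (Equiv.sigmaFiberEquiv g).summable_iff.mpr hf
  rw [← (Equiv.sigmaFiberEquiv g).tsum_eq, ← tsum_fintype (L := .unconditional _)]
  exact h.tsum_sigma

open Asymptotics in
lemma summable_and_tendsto_of_tendsto_card_div {ι : Type*} (N : ι → ℕ) (hN : ∀ i, N i ≠ 0)
    (hfin : ∀ k, Finite {i // N i = k}) {κ : ℝ}
    (hκ : Tendsto (fun s : ℝ => (Nat.card {i // (N i : ℝ) ≤ s} : ℝ) / s) atTop (𝓝 κ)) :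
    (∀ s : ℝ, 1 < s → Summable fun i => (N i : ℝ) ^ (-s)) ∧
      Tendsto (fun s : ℝ => (s - 1) * ∑' i, (N i : ℝ) ^ (-s)) (𝓝[>] 1) (𝓝 κ) := by
  let f : ℕ → ℝ := fun k => Nat.card {i // N i = k}
  have hf0 : ∀ k, 0 ≤ f k := fun k => Nat.cast_nonneg _
  have hcard : ∀ n : ℕ, ∑ k ∈ Finset.Icc 1 n, f k = Nat.card {i // (N i : ℝ) ≤ n} := by
    intro n
    simp only [f, ← Nat.cast_sum, Nat.cast_le]
    congr 1
    have e : {i // N i ≤ n} ≃ Σ k : Finset.Icc 1 n, {i // N i = k} :=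
      { toFun := fun i =>
          ⟨⟨N i, Finset.mem_Icc.mpr ⟨Nat.one_le_iff_ne_zero.mpr (hN _), i.2⟩⟩, i, rfl⟩
        invFun := fun x => ⟨x.2, x.2.2.trans_le (Finset.mem_Icc.mp x.1.2).2⟩
        left_inv := fun _ => rfl
        right_inv := fun ⟨⟨k, hk⟩, i, hi⟩ => by
          change N i = k at hi
          subst hi
          rfl }
    rw [Nat.card_congr e, Nat.card_sigma, ← Finset.sum_coe_sort (Finset.Icc 1 n)]
  have hlim : Tendsto (fun n : ℕ => (∑ k ∈ Finset.Icc 1 n, f k) / (n : ℝ)) atTop (𝓝 κ) := by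
    refine (hκ.comp tendsto_natCast_atTop_atTop).congr fun n => ?_
    rw [Function.comp_apply, hcard]
  have hS : ∀ s : ℝ, 1 < s → LSeriesSummable (fun n => (f n : ℂ)) s := fun s hs =>
    LSeriesSummable_of_sum_norm_bigO_and_nonneg
      (isBigO_atTop_natCast_rpow_of_tendsto_div_rpow (by simpa)) hf0 zero_le_one hs
  have hterm : ∀ (s : ℝ) (k : ℕ), LSeries.term (fun n => (f n : ℂ)) s k =
      ((f k * (k : ℝ) ^ (-s) : ℝ) : ℂ) := by
    intro s k
    rcases eq_or_ne k 0 with rfl | hk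
    · have : f 0 = 0 := by
        have : IsEmpty {i // N i = 0} := ⟨fun i => hN _ i.2⟩
        simp [f]
      simp [this]
    · rw [LSeries.term_of_ne_zero hk, Real.rpow_neg (Nat.cast_nonneg k), Complex.ofReal_mul,
        Complex.ofReal_inv, Complex.ofReal_cpow (Nat.cast_nonneg k), div_eq_mul_inv]
      simp
  have hfib : ∀ (s : ℝ) (k : ℕ), HasSum (fun i : {i // N i = k} => (N i : ℝ) ^ (-s))
      (f k * (k : ℝ) ^ (-s)) := by
    intro s k
    have := hfin k
    have := Fintype.ofFinite {i // N i = k}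
    convert! hasSum_fintype (fun i : {i // N i = k} => (N i : ℝ) ^ (-s)) using 1
    rw [Finset.sum_congr rfl (fun i _ => by rw [i.2]), Finset.sum_const, nsmul_eq_mul,
      Finset.card_univ, ← Nat.card_eq_fintype_card]
  have hsumm : ∀ s : ℝ, 1 < s → HasSum (fun i => (N i : ℝ) ^ (-s))
      (∑' k, f k * (k : ℝ) ^ (-s)) := by
    intro s hs
    have h1 : Summable fun k : ℕ => f k * (k : ℝ) ^ (-s) := by
      have := hS s hs
      rw [LSeriesSummable, funext (hterm s)] at this
      exact Complex.summable_ofReal.mp this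
    rw [← (Equiv.sigmaFiberEquiv N).hasSum_iff]
    have h2 : Summable fun x : Σ k, {i // N i = k} => (N x.2 : ℝ) ^ (-s) := by
      rw [summable_sigma_of_nonneg fun _ => by positivity]
      exact ⟨fun k => (hfib s k).summable, by simpa only [(hfib s _).tsum_eq] using h1⟩
    convert! h2.hasSum using 1
    rw [h2.tsum_sigma]
    exact tsum_congr fun k => (hfib s k).tsum_eq.symm
  refine ⟨fun s hs => (hsumm s hs).summable, ?_⟩
  have h3 := LSeries_tendsto_sub_mul_nhds_one_of_tendsto_sum_div_and_nonneg f hlim hf0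
  rw [← Complex.ofReal_re κ]
  refine ((Complex.continuous_re.tendsto _).comp h3).congr' ?_
  filter_upwards [self_mem_nhdsWithin] with s hs
  rw [(hsumm s hs).tsum_eq, Function.comp_apply, LSeries, tsum_congr (hterm s),
    ← Complex.ofReal_tsum, ← Complex.ofReal_one, ← Complex.ofReal_sub, ← Complex.ofReal_mul,
    Complex.ofReal_re]

variable (K : Type*) [Field K] [NumberField K]

lemma absNorm_coe_ne_zero (a : (Ideal (𝓞 K))⁰) : Ideal.absNorm (a : Ideal (𝓞 K)) ≠ 0 := by
  rw [Ne, Ideal.absNorm_eq_zero_iff]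
  exact nonZeroDivisors.coe_ne_zero a

lemma finite_absNorm_eq (P : (Ideal (𝓞 K))⁰ → Prop) (k : ℕ) :
    Finite {i : {a // P a} // Ideal.absNorm ((i : (Ideal (𝓞 K))⁰) : Ideal (𝓞 K)) = k} := by
  have := (Ideal.finite_setOfPred_absNorm_eq (S := 𝓞 K) k).to_subtype
  refine Finite.of_injective (β := {I : Ideal (𝓞 K) | Ideal.absNorm I = k})
    (fun i => ⟨i.1.1, i.2⟩) fun i j h => ?_
  exact Subtype.ext (Subtype.ext (Subtype.ext (Subtype.mk.inj h)))

lemma summable_absNorm_rpow {s : ℝ} (hs : 1 < s) :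
    Summable fun a : (Ideal (𝓞 K))⁰ => (Ideal.absNorm (a : Ideal (𝓞 K)) : ℝ) ^ (-s) :=
  (summable_and_tendsto_of_tendsto_card_div _ (absNorm_coe_ne_zero K)
    (fun k => by
      have := (Ideal.finite_setOfPred_absNorm_eq (S := 𝓞 K) k).to_subtype
      exact Finite.of_injective (β := {I : Ideal (𝓞 K) | Ideal.absNorm I = k})
        (fun i => ⟨i.1, i.2⟩) fun i j h => Subtype.ext (Subtype.ext (Subtype.mk.inj h)))
    (NumberField.Ideal.tendsto_norm_le_div_atTop₀ K)).1 s hs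

lemma exists_tendsto_sub_one_mul_tsum_class :
    ∃ κ : ℝ, ∀ c : ClassGroup (𝓞 K), Tendsto (fun s : ℝ => (s - 1) *
      ∑' a : {a : (Ideal (𝓞 K))⁰ // ClassGroup.mk0 a = c},
        (Ideal.absNorm (a : Ideal (𝓞 K)) : ℝ) ^ (-s)) (𝓝[>] 1) (𝓝 κ) := by
  refine ⟨_, fun c => (summable_and_tendsto_of_tendsto_card_div
    (fun a : {a : (Ideal (𝓞 K))⁰ // ClassGroup.mk0 a = c} =>
      Ideal.absNorm ((a : (Ideal (𝓞 K))⁰) : Ideal (𝓞 K)))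
    (fun a => absNorm_coe_ne_zero K a) (fun k => finite_absNorm_eq K _ k)
    ((NumberField.Ideal.tendsto_norm_le_and_mk_eq_div_atTop K c).congr fun s => ?_)).2⟩
  congr 2
  refine Nat.card_congr
    { toFun := fun i => ⟨⟨i.1, i.2.2⟩, i.2.1⟩
      invFun := fun i => ⟨i.1.1, i.2, i.1.2⟩
      left_inv := fun _ => rfl
      right_inv := fun _ => rfl }

/-- The trivially twisted Hecke series of a nontrivial class group character has no pole. -/
lemma tendsto_sub_one_mul_tsum_classChar (χ : ClassGroup (𝓞 K) →* ℂ) (hχ : χ ≠ 1) :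
    Tendsto (fun s : ℝ => ((s - 1 : ℝ) : ℂ) * ∑' a : (Ideal (𝓞 K))⁰,
      χ (ClassGroup.mk0 a) * ((Ideal.absNorm (a : Ideal (𝓞 K)) : ℝ) ^ (-s) : ℝ))
      (𝓝[>] 1) (𝓝 0) := by
  classical
  obtain ⟨κ, hκ⟩ := exists_tendsto_sub_one_mul_tsum_class K
  have h1 : Tendsto (fun s : ℝ => ∑ c : ClassGroup (𝓞 K), χ c * (((s - 1) *
      ∑' a : {a : (Ideal (𝓞 K))⁰ // ClassGroup.mk0 a = c},
        (Ideal.absNorm (a : Ideal (𝓞 K)) : ℝ) ^ (-s) : ℝ) : ℂ)) (𝓝[>] 1)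
      (𝓝 (∑ c : ClassGroup (𝓞 K), χ c * κ)) :=
    tendsto_finsetSum _ fun c _ => ((hκ c).ofReal).const_mul _
  rw [← Finset.sum_mul, sum_hom_units, if_neg hχ] at h1
  simp only [Nat.cast_zero, zero_mul] at h1
  refine h1.congr' ?_
  filter_upwards [self_mem_nhdsWithin] with s hs
  have hsum : Summable fun a : (Ideal (𝓞 K))⁰ =>
      χ (ClassGroup.mk0 a) * ((Ideal.absNorm (a : Ideal (𝓞 K)) : ℝ) ^ (-s) : ℝ) := by
    obtain ⟨B, hB⟩ := (Set.finite_range fun c => ‖χ c‖).bddAbove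
    refine Summable.of_norm_bounded ((summable_absNorm_rpow K hs).mul_left B) fun a => ?_
    rw [norm_mul, Complex.norm_real, Real.norm_of_nonneg (by positivity)]
    exact mul_le_mul_of_nonneg_right (hB ⟨_, rfl⟩) (by positivity)
  rw [tsum_eq_sum_tsum_fiber (ClassGroup.mk0 (R := 𝓞 K)) hsum, Finset.mul_sum]
  refine Finset.sum_congr rfl fun c _ => ?_
  rw [Complex.ofReal_mul, mul_left_comm, Complex.ofReal_tsum, ← tsum_mul_left]
  congr 1
  refine tsum_congr fun a => ?_
  rw [a.2]

end NormSeries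

section LatticeSum

/-- The homogeneous weight of degree `-2 * s` on `ℝ²` attached to a fundamental unit of a real
quadratic field, with `A` and `B` the fourth powers of the conjugates of the unit. -/
def unitKernel (A B s : ℝ) (v : ℝ × ℝ) : ℝ :=
  |v.1 * v.2| ^ (4 - s) / ((v.1 ^ 4 + v.2 ^ 4) * (A * v.1 ^ 4 + B * v.2 ^ 4))

lemma abs_rpow_sub_rpow_le {x y M e : ℝ} (hx : 0 ≤ x) (hy : 0 ≤ y) (hxM : x ≤ M) (hyM : y ≤ M)
    (hM : 1 ≤ M) (he : 2 ≤ e) (he' : e ≤ 3) : |x ^ e - y ^ e| ≤ 3 * M ^ 2 * |x - y| := by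
  wlog hxy : y ≤ x generalizing x y
  · rw [abs_sub_comm, abs_sub_comm x]
    exact this hy hx hyM hxM (le_of_not_ge hxy)
  have hle : y ^ e ≤ x ^ e := Real.rpow_le_rpow hy hxy (by linarith)
  rw [abs_of_nonneg (sub_nonneg.mpr hle), abs_of_nonneg (sub_nonneg.mpr hxy)]
  rcases hx.eq_or_lt with rfl | hx0
  · obtain rfl : y = 0 := le_antisymm hxy hy
    simp
  have h1 := one_add_mul_self_le_rpow_one_add (s := y / x - 1) (p := e)
    (by have := div_nonneg hy hx; linarith) (by linarith)
  rw [add_sub_cancel, Real.div_rpow hy hx, le_div_iff₀ (Real.rpow_pos_of_pos hx0 e)] at h1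
  have h2 : x ^ e = x * x ^ (e - 1) := by
    rw [← Real.rpow_one_add' hx (by linarith)]; ring_nf
  have h3 : x ^ (e - 1) ≤ M ^ 2 := by
    rw [← Real.rpow_natCast]
    exact (Real.rpow_le_rpow hx hxM (by linarith)).trans
      (Real.rpow_le_rpow_of_exponent_le hM (by push_cast; linarith))
  have h4 : x ^ e - y ^ e ≤ e * (x ^ (e - 1) * (x - y)) := by
    have : (y / x - 1) * x ^ e = -(x ^ (e - 1) * (x - y)) := by
      rw [h2]; field_simp; ring
    nlinarith
  have h5 : x ^ (e - 1) * (x - y) ≤ M ^ 2 * (x - y) :=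
    mul_le_mul_of_nonneg_right h3 (sub_nonneg.mpr hxy)
  have h6 : 0 ≤ x ^ (e - 1) * (x - y) :=
    mul_nonneg (Real.rpow_nonneg hx _) (sub_nonneg.mpr hxy)
  nlinarith

lemma unitKernel_denom_ne_zero {A B : ℝ} (hA : 0 < A) (hB : 0 < B) {v : ℝ × ℝ} (hv : v ≠ 0) :
    (v.1 ^ 4 + v.2 ^ 4) * (A * v.1 ^ 4 + B * v.2 ^ 4) ≠ 0 := by
  have h1 : 0 ≤ v.1 ^ 4 := by positivity
  have h2 : 0 ≤ v.2 ^ 4 := by positivity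
  have h : 0 < v.1 ^ 4 ∨ 0 < v.2 ^ 4 := by
    by_contra! h
    exact hv (Prod.ext (eq_zero_of_pow_eq_zero (n := 4) (le_antisymm h.1 h1))
      (eq_zero_of_pow_eq_zero (n := 4) (le_antisymm h.2 h2)))
  rcases h with h | h <;> positivity

lemma exists_unitKernel_annulus {A B : ℝ} (hA : 0 < A) (hB : 0 < B) {R : ℝ} (hR : 1 ≤ R) :
    ∃ L : ℝ, 0 ≤ L ∧ ∀ s : ℝ, 1 ≤ s → s ≤ 2 → ∀ u u' : ℝ × ℝ, 1 ≤ ‖u‖ → ‖u‖ ≤ R → 1 ≤ ‖u'‖ →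
      ‖u'‖ ≤ R → |unitKernel A B s u| ≤ L ∧
        |unitKernel A B s u - unitKernel A B s u'| ≤ L * ‖u - u'‖ := by
  let d : ℝ × ℝ → ℝ := fun v => ((v.1 ^ 4 + v.2 ^ 4) * (A * v.1 ^ 4 + B * v.2 ^ 4))⁻¹
  let S : Set (ℝ × ℝ) := {v | 1 ≤ ‖v‖ ∧ ‖v‖ ≤ R}
  have hS : IsCompact S := by
    have : S = Metric.closedBall 0 R ∩ {v | 1 ≤ ‖v‖} := by
      ext v; simp [S, and_comm]
    rw [this]
    exact (isCompact_closedBall 0 R).inter_right (isClosed_le continuous_const continuous_norm)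
  have hd : LocallyLipschitzOn S d := by
    intro x hx
    have hx0 : x ≠ 0 := norm_pos_iff.mp (zero_lt_one.trans_le hx.1)
    have h1 : ContDiffAt ℝ 1 d x := by
      refine ContDiffAt.inv ?_ (unitKernel_denom_ne_zero hA hB hx0)
      fun_prop
    obtain ⟨k, t, ht, hk⟩ := h1.exists_lipschitzOnWith
    exact ⟨k, t, mem_nhdsWithin_of_mem_nhds ht, hk⟩
  obtain ⟨k, hk⟩ := hd.exists_lipschitzOnWith_of_compact hS
  obtain ⟨D, hD⟩ := hS.exists_bound_of_continuousOn hk.continuousOn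
  have hfst : ∀ u : ℝ × ℝ, ‖u‖ ≤ R → |u.1| ≤ R := fun u hu => (norm_fst_le u).trans hu
  have hsnd : ∀ u : ℝ × ℝ, ‖u‖ ≤ R → |u.2| ≤ R := fun u hu => (norm_snd_le u).trans hu
  have hprod : ∀ u : ℝ × ℝ, ‖u‖ ≤ R → |u.1 * u.2| ≤ R ^ 2 := fun u hu => by
    rw [abs_mul, sq]
    exact mul_le_mul (hfst u hu) (hsnd u hu) (abs_nonneg _) (by linarith)
  have hp : ∀ s : ℝ, 1 ≤ s → s ≤ 2 → ∀ u : ℝ × ℝ, ‖u‖ ≤ R → |u.1 * u.2| ^ (4 - s) ≤ R ^ 6 := by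
    intro s hs hs' u hu
    have h1 : (1 : ℝ) ≤ R ^ 2 := one_le_pow₀ hR
    calc |u.1 * u.2| ^ (4 - s) ≤ (R ^ 2) ^ (4 - s) :=
          Real.rpow_le_rpow (abs_nonneg _) (hprod u hu) (by linarith)
      _ ≤ (R ^ 2) ^ ((3 : ℕ) : ℝ) := Real.rpow_le_rpow_of_exponent_le h1 (by push_cast; linarith)
      _ = R ^ 6 := by rw [Real.rpow_natCast, ← pow_mul]
  have hR0 : 0 ≤ R := zero_le_one.trans hR
  have hRn : ‖((R, 0) : ℝ × ℝ)‖ = R := by simp [Prod.norm_def, abs_of_nonneg hR0, hR0]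
  have hD0 : 0 ≤ D := (norm_nonneg _).trans (hD (R, 0) ⟨hR.trans hRn.ge, hRn.le⟩)
  refine ⟨R ^ 6 * D + R ^ 6 * k + 6 * R ^ 5 * D, by positivity, ?_⟩
  intro s hs hs' u u' hu1 hu2 hu1' hu2'
  have hpu := hp s hs hs' u hu2
  have hpu0 : 0 ≤ |u.1 * u.2| ^ (4 - s) := by positivity
  have hdu' := hD u' ⟨hu1', hu2'⟩
  constructor
  · rw [unitKernel, div_eq_mul_inv, abs_mul, abs_of_nonneg hpu0]
    have h1 : |u.1 * u.2| ^ (4 - s) * |d u| ≤ R ^ 6 * D :=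
      mul_le_mul hpu (hD u ⟨hu1, hu2⟩) (abs_nonneg _) (by positivity)
    refine h1.trans ?_
    have : 0 ≤ R ^ 6 * k + 6 * R ^ 5 * D := by positivity
    linarith
  · have h1 : unitKernel A B s u - unitKernel A B s u' = |u.1 * u.2| ^ (4 - s) * (d u - d u') +
        (|u.1 * u.2| ^ (4 - s) - |u'.1 * u'.2| ^ (4 - s)) * d u' := by
      simp only [unitKernel, d, div_eq_mul_inv]; ring
    have h2 : |d u - d u'| ≤ k * ‖u - u'‖ := by
      have := hk.dist_le_mul u ⟨hu1, hu2⟩ u' ⟨hu1', hu2'⟩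
      rwa [dist_eq_norm, dist_eq_norm] at this
    have h3 : |(|u.1 * u.2| - |u'.1 * u'.2|)| ≤ 2 * R * ‖u - u'‖ := by
      refine (abs_abs_sub_abs_le_abs_sub _ _).trans ?_
      have : u.1 * u.2 - u'.1 * u'.2 = u.1 * (u - u').2 + (u - u').1 * u'.2 := by
        simp only [Prod.fst_sub, Prod.snd_sub]; ring
      rw [this]
      refine (abs_add_le _ _).trans ?_
      rw [abs_mul, abs_mul]
      have e1 : |u.1| * |(u - u').2| ≤ R * ‖u - u'‖ :=
        mul_le_mul (hfst u hu2) (norm_snd_le (u - u')) (abs_nonneg _) hR0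
      have e2 : |(u - u').1| * |u'.2| ≤ ‖u - u'‖ * R :=
        mul_le_mul (norm_fst_le (u - u')) (hsnd u' hu2') (abs_nonneg _) (norm_nonneg _)
      linarith
    have h4 := abs_rpow_sub_rpow_le (abs_nonneg _) (abs_nonneg _) (hprod u hu2) (hprod u' hu2')
      (one_le_pow₀ hR) (show 2 ≤ 4 - s by linarith) (by linarith)
    rw [h1]
    refine (abs_add_le _ _).trans ?_
    rw [abs_mul (|u.1 * u.2| ^ (4 - s)) (d u - d u'), abs_mul _ (d u'), abs_of_nonneg hpu0]
    have e1 : |u.1 * u.2| ^ (4 - s) * |d u - d u'| ≤ R ^ 6 * (k * ‖u - u'‖) :=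
      mul_le_mul hpu h2 (abs_nonneg _) (by positivity)
    have e2 : |(|u.1 * u.2| ^ (4 - s) - |u'.1 * u'.2| ^ (4 - s))| * |d u'| ≤
        (3 * (R ^ 2) ^ 2 * (2 * R * ‖u - u'‖)) * D := by
      refine mul_le_mul (h4.trans ?_) hdu' (abs_nonneg _) (by positivity)
      exact mul_le_mul_of_nonneg_left h3 (by positivity)
    have e3 : 0 ≤ R ^ 6 * D * ‖u - u'‖ := by positivity
    linarith

lemma unitKernel_smul (A B s : ℝ) {t : ℝ} (ht : 0 < t) (v : ℝ × ℝ) :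
    unitKernel A B s (t • v) = t ^ (-(2 * s)) * unitKernel A B s v := by
  have h1 : t ^ (-(2 * s)) = (t ^ 2) ^ (4 - s) / t ^ 8 := by
    rw [← Real.rpow_natCast t 2, ← Real.rpow_natCast t 8, ← Real.rpow_mul ht.le,
      ← Real.rpow_sub ht]
    congr 1
    push_cast
    ring
  have h2 : |(t • v).1 * (t • v).2| ^ (4 - s) = (t ^ 2) ^ (4 - s) * |v.1 * v.2| ^ (4 - s) := by
    have : (t • v).1 * (t • v).2 = t ^ 2 * (v.1 * v.2) := by
      simp only [Prod.smul_fst, Prod.smul_snd, smul_eq_mul]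
      ring
    rw [← Real.mul_rpow (by positivity) (abs_nonneg _), this, abs_mul,
      abs_of_nonneg (sq_nonneg t)]
  rw [unitKernel, unitKernel, h1, h2, div_mul_div_comm]
  congr 1
  simp only [Prod.smul_fst, Prod.smul_snd, smul_eq_mul]
  ring

lemma exists_unitKernel_bound {A B : ℝ} (hA : 0 < A) (hB : 0 < B) {R c : ℝ} (hR : 1 ≤ R)
    (hc : 0 < c) (hc1 : c ≤ 1) :
    ∃ L : ℝ, 0 ≤ L ∧ ∀ s : ℝ, 1 ≤ s → s ≤ 2 →
      (∀ v, v ≠ 0 → |unitKernel A B s v| ≤ L * ‖v‖ ^ (-(2 * s))) ∧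
      ∀ μ, c ≤ μ → ∀ v v' : ℝ × ℝ, μ ≤ ‖v‖ → ‖v‖ ≤ R * μ → μ ≤ ‖v'‖ → ‖v'‖ ≤ R * μ →
        |unitKernel A B s v - unitKernel A B s v'| ≤ L * ‖v - v'‖ * μ ^ (-3 : ℝ) := by
  obtain ⟨L, hL0, hL⟩ := exists_unitKernel_annulus hA hB hR
  have hcc : 1 ≤ c ^ (-2 : ℝ) := Real.one_le_rpow_of_pos_of_le_one_of_nonpos hc hc1 (by norm_num)
  refine ⟨L * c ^ (-2 : ℝ), by positivity, fun s hs hs' => ⟨fun v hv => ?_, ?_⟩⟩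
  · have hv0 : 0 < ‖v‖ := norm_pos_iff.mpr hv
    have hu : ‖‖v‖⁻¹ • v‖ = 1 := by
      rw [norm_smul, norm_inv, norm_norm, inv_mul_cancel₀ hv0.ne']
    have h1 := (hL s hs hs' (‖v‖⁻¹ • v) (‖v‖⁻¹ • v) hu.ge (hu.le.trans hR) hu.ge (hu.le.trans hR)).1
    have h2 := unitKernel_smul A B s hv0 (‖v‖⁻¹ • v)
    rw [smul_inv_smul₀ hv0.ne'] at h2
    rw [h2, abs_mul, abs_of_nonneg (by positivity), mul_comm]
    exact mul_le_mul_of_nonneg_right (h1.trans (le_mul_of_one_le_right hL0 hcc)) (by positivity)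
  · intro μ hμ v v' h1 h2 h1' h2'
    have hμ0 : 0 < μ := hc.trans_le hμ
    have hn : ∀ w : ℝ × ℝ, ‖μ⁻¹ • w‖ = ‖w‖ / μ := fun w => by
      rw [norm_smul, norm_inv, Real.norm_of_nonneg hμ0.le, inv_mul_eq_div]
    have h3 := (hL s hs hs' (μ⁻¹ • v) (μ⁻¹ • v') (by rwa [hn, le_div_iff₀ hμ0, one_mul])
      (by rwa [hn, div_le_iff₀ hμ0]) (by rwa [hn, le_div_iff₀ hμ0, one_mul])
      (by rwa [hn, div_le_iff₀ hμ0])).2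
    rw [← smul_sub, hn] at h3
    have h4 := unitKernel_smul A B s hμ0 (μ⁻¹ • v)
    have h4' := unitKernel_smul A B s hμ0 (μ⁻¹ • v')
    rw [smul_inv_smul₀ hμ0.ne'] at h4 h4'
    rw [h4, h4', ← mul_sub, abs_mul, abs_of_nonneg (by positivity)]
    have h5 : μ ^ (-(2 * s)) * μ⁻¹ ≤ c ^ (-2 : ℝ) * μ ^ (-3 : ℝ) := by
      have e1 : μ ^ (-(2 * s)) * μ⁻¹ = μ ^ (-(2 * (s - 1))) * μ ^ (-3 : ℝ) := by
        rw [← Real.rpow_neg_one, ← Real.rpow_add hμ0, ← Real.rpow_add hμ0]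
        congr 1; ring
      rw [e1]
      refine mul_le_mul_of_nonneg_right ?_ (by positivity)
      calc μ ^ (-(2 * (s - 1))) ≤ c ^ (-(2 * (s - 1))) :=
            Real.rpow_le_rpow_of_nonpos hc hμ (by linarith)
        _ ≤ c ^ (-2 : ℝ) := Real.rpow_le_rpow_of_exponent_ge hc hc1 (by linarith)
    calc μ ^ (-(2 * s)) * |unitKernel A B s (μ⁻¹ • v) - unitKernel A B s (μ⁻¹ • v')|
        ≤ μ ^ (-(2 * s)) * (L * (‖v - v'‖ / μ)) :=
          mul_le_mul_of_nonneg_left h3 (by positivity)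
      _ = L * ‖v - v'‖ * (μ ^ (-(2 * s)) * μ⁻¹) := by ring
      _ ≤ L * ‖v - v'‖ * (c ^ (-2 : ℝ) * μ ^ (-3 : ℝ)) :=
          mul_le_mul_of_nonneg_left h5 (by positivity)
      _ = _ := by ring

end LatticeSum

section LatticeSum

/-- Division with remainder by `m` in each coordinate. -/
def divModEquiv (m : ℕ) [NeZero m] : (Fin 2 → ℤ) ≃ (Fin 2 → ℤ) × (Fin 2 → ZMod m) where
  toFun x := (fun i => x i / m, fun i => x i)
  invFun p := fun i => m * p.1 i + (p.2 i).val
  left_inv x := by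
    funext i
    simp only [ZMod.val_intCast]
    exact Int.mul_ediv_add_emod _ _
  right_inv p := by
    have hm : (m : ℤ) ≠ 0 := by exact_mod_cast NeZero.ne m
    refine Prod.ext (funext fun i => ?_) (funext fun i => ?_)
    · have h : ((p.2 i).val : ℤ) / m = 0 :=
        Int.ediv_eq_zero_of_lt (by positivity) (by exact_mod_cast ZMod.val_lt (p.2 i))
      simp only [add_comm ((m : ℤ) * _)]
      rw [Int.add_mul_ediv_left _ _ hm, h, zero_add]
    · simp

lemma unitKernel_zero (A B s : ℝ) : unitKernel A B s 0 = 0 := by simp [unitKernel]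

lemma exists_norm_tsum_unitKernel_le {m : ℕ} [NeZero m] (w : (Fin 2 → ZMod m) → ℂ)
    (hw : ∀ z, ‖w z‖ ≤ 1) (h0 : ∑ z, w z = 0) (v : (Fin 2 → ℤ) →+ ℝ × ℝ) {c : ℝ} (hc : 0 < c)
    (hc1 : c ≤ 1) (hv : ∀ x, c * ‖x‖ ≤ ‖v x‖) {A B : ℝ} (hA : 0 < A) (hB : 0 < B) :
    ∃ C : ℝ, ∀ s : ℝ, 1 < s → s ≤ 2 → Summable (fun x => unitKernel A B s (v x)) ∧
      ‖∑' x : Fin 2 → ℤ, w (fun i => x i) * (unitKernel A B s (v x) : ℂ)‖ ≤ C := by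
  have hmpos : (1 : ℝ) ≤ m := by exact_mod_cast NeZero.one_le
  obtain ⟨D, hD0, hD⟩ : ∃ D : ℝ, 0 ≤ D ∧ ∀ x, ‖v x‖ ≤ D * ‖x‖ := by
    refine ⟨‖v (Pi.single 0 1)‖ + ‖v (Pi.single 1 1)‖, by positivity, fun x => ?_⟩
    have hx : x = x 0 • Pi.single 0 1 + x 1 • Pi.single 1 1 := by
      funext i; fin_cases i <;> simp
    have h : v x = x 0 • v (Pi.single 0 1) + x 1 • v (Pi.single 1 1) := by
      conv_lhs => rw [hx]
      rw [map_add, map_zsmul, map_zsmul]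
    rw [h, add_mul]
    have hi : ∀ i (u : ℝ × ℝ), ‖x i • u‖ ≤ ‖u‖ * ‖x‖ := fun i u => by
      rw [mul_comm]
      refine (norm_smul_le (x i) u).trans ?_
      exact mul_le_mul_of_nonneg_right (norm_le_pi_norm x i) (norm_nonneg _)
    exact (norm_add_le _ _).trans (add_le_add (hi _ _) (hi _ _))
  obtain ⟨L, hL0, hL⟩ := exists_unitKernel_bound hA hB (le_max_left 1 (4 * D / c)) hc hc1
  set y : (Fin 2 → ℤ) → (Fin 2 → ℤ) := fun x i => m * (x i / m) with hy
  have hxy : ∀ x, ‖x - y x‖ ≤ m := fun x => by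
    refine (pi_norm_le_iff_of_nonneg (by positivity)).mpr fun i => ?_
    have h1 : (x - y x) i = x i % m := by
      simp only [Pi.sub_apply, hy]
      rw [Int.emod_def]
    have h2 : 0 ≤ x i % m := Int.emod_nonneg _ (by exact_mod_cast NeZero.ne m)
    have h3 : x i % m < m := Int.emod_lt_of_pos _ (by exact_mod_cast NeZero.pos m)
    rw [h1, Int.norm_eq_abs, abs_of_nonneg (by exact_mod_cast h2)]
    exact_mod_cast h3.le
  have hone : ∀ x : Fin 2 → ℤ, x ≠ 0 → 1 ≤ ‖x‖ := fun x hx => by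
    obtain ⟨i, hi⟩ := Function.ne_iff.mp hx
    refine le_trans ?_ (norm_le_pi_norm x i)
    rw [Int.norm_eq_abs]
    exact_mod_cast Int.one_le_abs hi
  have hG : ∀ s : ℝ, 1 < s → s ≤ 2 → ∀ x : Fin 2 → ℤ, x ≠ 0 →
      |unitKernel A B s (v x)| ≤ L * c ^ (-4 : ℝ) * ‖x‖ ^ (-(2 * s)) := by
    intro s hs hs' x hx
    have h1 := hone x hx
    have hpos : 0 < c * ‖x‖ := by positivity
    have hvx : v x ≠ 0 := norm_pos_iff.mp (hpos.trans_le (hv x))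
    refine ((hL s hs.le hs').1 _ hvx).trans ?_
    rw [mul_assoc]
    refine mul_le_mul_of_nonneg_left ?_ hL0
    refine (Real.rpow_le_rpow_of_nonpos hpos (hv x) (by linarith)).trans ?_
    rw [Real.mul_rpow hc.le (by positivity)]
    refine mul_le_mul_of_nonneg_right ?_ (by positivity)
    exact Real.rpow_le_rpow_of_exponent_ge hc hc1 (by linarith)
  have hGb : ∀ s : ℝ, 1 < s → s ≤ 2 → ∀ x : Fin 2 → ℤ,
      |unitKernel A B s (v x)| ≤ L * c ^ (-4 : ℝ) := by
    intro s hs hs' x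
    rcases eq_or_ne x 0 with rfl | hx
    · rw [map_zero, unitKernel_zero, abs_zero]; positivity
    · refine (hG s hs hs' x hx).trans (mul_le_of_le_one_right (by positivity) ?_)
      exact Real.rpow_le_one_of_one_le_of_nonpos (hone x hx) (by linarith)
  have hsum3 : Summable fun x : Fin 2 → ℤ => ‖x‖ ^ (-3 : ℝ) :=
    EisensteinSeries.summable_one_div_norm_rpow (by norm_num)
  obtain ⟨M, hM0, hM⟩ : ∃ M : ℝ, 0 ≤ M ∧ ∀ s : ℝ, 1 < s → s ≤ 2 → ∀ x,
      |unitKernel A B s (v x) - unitKernel A B s (v (y x))| ≤ M * ‖x‖ ^ (-3 : ℝ) := by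
    refine ⟨max (L * (D * m) * (c / 2) ^ (-3 : ℝ))
      (2 * (L * c ^ (-4 : ℝ)) * (2 * m) ^ (3 : ℝ)), by positivity, fun s hs hs' x => ?_⟩
    rcases le_or_gt (2 * (m : ℝ)) ‖x‖ with hx | hx
    · have hx0 : 0 < ‖x‖ := by linarith
      have h1 := hxy x
      have h2 : ‖x‖ ≤ ‖x - y x‖ + ‖y x‖ := by simpa using norm_add_le (x - y x) (y x)
      have h3 : ‖y x‖ ≤ ‖x - y x‖ + ‖x‖ := by
        have := norm_sub_le x (x - y x)
        rw [sub_sub_cancel] at this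
        linarith
      have hDx : ‖v x‖ ≤ D * ‖x‖ := hD x
      have hDy : ‖v (y x)‖ ≤ D * ‖y x‖ := hD (y x)
      have hyx : D * ‖y x‖ ≤ D * (2 * ‖x‖) := mul_le_mul_of_nonneg_left (by linarith) hD0
      have hcy : c * (‖x‖ / 2) ≤ c * ‖y x‖ := mul_le_mul_of_nonneg_left (by linarith) hc.le
      have hR : D * (2 * ‖x‖) ≤ max 1 (4 * D / c) * (c / 2 * ‖x‖) := by
        calc D * (2 * ‖x‖) = 4 * D / c * (c / 2 * ‖x‖) := by field_simp; ring
          _ ≤ _ := mul_le_mul_of_nonneg_right (le_max_right _ _) (by positivity)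
      have hDx' : D * ‖x‖ ≤ D * (2 * ‖x‖) := mul_le_mul_of_nonneg_left (by linarith) hD0
      have h4 := (hL s hs.le hs').2 (c / 2 * ‖x‖) (by nlinarith) (v x) (v (y x))
        (by have := hv x; nlinarith) (by linarith) (by have := hv (y x); nlinarith) (by linarith)
      refine (h4.trans ?_).trans
        (mul_le_mul_of_nonneg_right (le_max_left _ _) (by positivity))
      rw [Real.mul_rpow (by positivity) (by positivity), ← mul_assoc, ← map_sub]
      refine mul_le_mul_of_nonneg_right ?_ (by positivity)
      refine mul_le_mul_of_nonneg_right ?_ (by positivity)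
      refine mul_le_mul_of_nonneg_left ?_ hL0
      exact (hD _).trans (mul_le_mul_of_nonneg_left h1 hD0)
    · rcases eq_or_ne x 0 with rfl | hx0
      · have : y 0 = 0 := by funext i; simp [hy]
        rw [this, sub_self, abs_zero]
        positivity
      · refine le_trans ?_ (mul_le_mul_of_nonneg_right (le_max_right _ _) (by positivity))
        have h1 : 1 ≤ (2 * (m : ℝ)) ^ (3 : ℝ) * ‖x‖ ^ (-3 : ℝ) := by
          have h2 := hone x hx0
          rw [Real.rpow_neg (by positivity), ← div_eq_mul_inv, one_le_div (by positivity)]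
          exact Real.rpow_le_rpow (by positivity) hx.le (by norm_num)
        have h2 : |unitKernel A B s (v x) - unitKernel A B s (v (y x))| ≤
            2 * (L * c ^ (-4 : ℝ)) := by
          refine (abs_sub _ _).trans ?_
          have e1 := hGb s hs hs' x
          have e2 := hGb s hs hs' (y x)
          linarith
        rw [mul_assoc]
        exact h2.trans (le_mul_of_one_le_right (by positivity) h1)
  refine ⟨∑' x : Fin 2 → ℤ, M * ‖x‖ ^ (-3 : ℝ), fun s hs hs' => ?_⟩
  have hsG : Summable fun x => unitKernel A B s (v x) := by
    refine Summable.of_norm_bounded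
      ((EisensteinSeries.summable_one_div_norm_rpow (k := 2 * s) (by linarith)).mul_left
        (L * c ^ (-4 : ℝ))) fun x => ?_
    rcases eq_or_ne x 0 with rfl | hx
    · rw [map_zero, unitKernel_zero, norm_zero]
      positivity
    · exact hG s hs hs' x hx
  refine ⟨hsG, ?_⟩
  set W : (Fin 2 → ℤ) → ℂ := fun x => w (fun i => x i) with hW
  have hdiff : Summable fun x =>
      ‖W x * ((unitKernel A B s (v x) - unitKernel A B s (v (y x)) : ℝ) : ℂ)‖ := by
    refine Summable.of_nonneg_of_le (fun _ => norm_nonneg _) (fun x => ?_) (hsum3.mul_left M)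
    rw [norm_mul, Complex.norm_real]
    exact (mul_le_of_le_one_left (norm_nonneg _) (hw _)).trans (hM s hs hs' x)
  have hsW : Summable fun x => W x * (unitKernel A B s (v x) : ℂ) := by
    refine Summable.of_norm_bounded hsG.abs fun x => ?_
    rw [norm_mul, Complex.norm_real]
    exact mul_le_of_le_one_left (norm_nonneg _) (hw _)
  have hsy : Summable fun x => W x * (unitKernel A B s (v (y x)) : ℂ) := by
    refine (hsW.sub hdiff.of_norm).congr fun x => ?_
    push_cast
    ring
  have hy0 : ∑' x, W x * (unitKernel A B s (v (y x)) : ℂ) = 0 := by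
    have he : ∀ p : (Fin 2 → ℤ) × (Fin 2 → ZMod m),
        W ((divModEquiv m).symm p) * (unitKernel A B s (v (y ((divModEquiv m).symm p))) : ℂ) =
          w p.2 * (unitKernel A B s (v (fun i => m * p.1 i)) : ℂ) := fun p => by
      have h := (divModEquiv m).apply_symm_apply p
      have h1 : (fun i => (divModEquiv m).symm p i / (m : ℤ)) = p.1 := congrArg Prod.fst h
      have h2 : (fun i => (((divModEquiv m).symm p i : ℤ) : ZMod m)) = p.2 := congrArg Prod.snd h
      simp only [hW, hy, h2]
      congr 5
      funext i
      rw [← congrFun h1 i]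
    rw [← (divModEquiv m).symm.tsum_eq]
    have hs2 := (divModEquiv m).symm.summable_iff.mpr hsy
    simp only [Function.comp_def] at hs2
    simp only [he] at hs2 ⊢
    rw [hs2.tsum_prod]
    simp only [tsum_fintype, ← Finset.sum_mul, h0, zero_mul, tsum_zero]
  have hfin : ∑' x, W x * (unitKernel A B s (v x) : ℂ) =
      ∑' x, W x * ((unitKernel A B s (v x) - unitKernel A B s (v (y x)) : ℝ) : ℂ) := by
    rw [← sub_zero (∑' x, W x * (unitKernel A B s (v x) : ℂ)), ← hy0, ← hsW.tsum_sub hsy]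
    refine tsum_congr fun x => ?_
    push_cast
    ring
  rw [hfin]
  refine (norm_tsum_le_tsum_norm hdiff).trans (hdiff.tsum_le_tsum (fun x => ?_) (hsum3.mul_left M))
  rw [norm_mul, Complex.norm_real]
  exact (mul_le_of_le_one_left (norm_nonneg _) (hw _)).trans (hM s hs hs' x)

end LatticeSum

section UnitSum

lemma hasSum_int_unitKernel_zero {a b : ℝ} (hb : b ≠ 0) (hab : |b| < |a|) {v : ℝ × ℝ}
    (h1 : v.1 ≠ 0) (h2 : v.2 ≠ 0) :
    HasSum (fun k : ℤ => unitKernel (a ^ 4) (b ^ 4) 0 (a ^ k * v.1, b ^ k * v.2))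
      (1 / (a ^ 4 - b ^ 4)) := by
  have ha : a ≠ 0 := by rintro rfl; simp at hab; linarith [abs_nonneg b]
  have hAB : b ^ 4 < a ^ 4 := by
    have := pow_lt_pow_left₀ hab (abs_nonneg b) (n := 4) (by norm_num)
    rwa [Even.pow_abs (by decide), Even.pow_abs (by decide)] at this
  have hA : 0 < a ^ 4 := by positivity
  have hB : 0 < b ^ 4 := by positivity
  have hv1 : 0 < v.1 ^ 4 := by positivity
  have hv2 : 0 < v.2 ^ 4 := by positivity
  set t : ℝ := b ^ 4 / a ^ 4 with ht
  have ht0 : 0 < t := by positivity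
  have ht1 : t < 1 := (div_lt_one hA).mpr hAB
  set ρ : ℝ := v.2 ^ 4 / v.1 ^ 4 with hρ
  have hρ0 : 0 < ρ := by positivity
  let P : ℤ → ℝ := fun k => ρ * t ^ k / (1 + ρ * t ^ k)
  have hterm : ∀ k : ℤ, unitKernel (a ^ 4) (b ^ 4) 0 (a ^ k * v.1, b ^ k * v.2) =
      (1 / (a ^ 4 - b ^ 4)) * (P k - P (k + 1)) := by
    intro k
    have e1 : a ^ 4 - b ^ 4 ≠ 0 := (sub_pos.mpr hAB).ne'
    have hx : 0 < (a ^ k) ^ 4 := by positivity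
    have hy : 0 < (b ^ k) ^ 4 := by positivity
    have htk : t ^ k = (b ^ k) ^ 4 / (a ^ k) ^ 4 := by
      rw [ht, div_zpow]
      congr 1 <;> (rw [← zpow_natCast, ← zpow_natCast, ← zpow_mul, ← zpow_mul, mul_comm])
    have htk1 : t ^ (k + 1) = (b ^ k) ^ 4 / (a ^ k) ^ 4 * (b ^ 4 / a ^ 4) := by
      rw [zpow_add_one₀ ht0.ne', htk]
    simp only [P]
    rw [htk, htk1, hρ, unitKernel]
    have e2 : |a ^ k * v.1 * (b ^ k * v.2)| ^ ((4 : ℝ) - 0) =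
        (a ^ k) ^ 4 * v.1 ^ 4 * ((b ^ k) ^ 4 * v.2 ^ 4) := by
      rw [sub_zero, show (4 : ℝ) = ((4 : ℕ) : ℝ) by norm_num, Real.rpow_natCast,
        Even.pow_abs (by decide)]
      ring
    simp only [e2, mul_pow]
    generalize (a ^ k) ^ 4 = x at *
    generalize (b ^ k) ^ 4 = y at *
    generalize v.1 ^ 4 = p at *
    generalize v.2 ^ 4 = q at *
    generalize a ^ 4 = A at *
    generalize b ^ 4 = B at *
    have n1 : x * p + y * q ≠ 0 := by positivity
    have n2 : A * (x * p) + B * (y * q) ≠ 0 := by positivity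
    have f1 : q / p * (y / x) / (1 + q / p * (y / x)) = y * q / (x * p + y * q) := by
      field_simp
    have f2 : q / p * (y / x * (B / A)) / (1 + q / p * (y / x * (B / A))) =
        B * (y * q) / (A * (x * p) + B * (y * q)) := by
      field_simp
    rw [f1, f2, div_sub_div _ _ n1 n2, one_div_mul_eq_div, div_div, div_eq_div_iff (by positivity)
      (mul_ne_zero (mul_ne_zero n1 n2) e1)]
    ring
  have hanti : ∀ k, P (k + 1) ≤ P k := fun k => by
    have h := hterm k
    have h0 : 0 ≤ unitKernel (a ^ 4) (b ^ 4) 0 (a ^ k * v.1, b ^ k * v.2) := by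
      unfold unitKernel; positivity
    rw [h] at h0
    have := nonneg_of_mul_nonneg_right h0 (one_div_pos.mpr (sub_pos.mpr hAB))
    linarith
  have hpow : Tendsto (fun k : ℕ => t ^ k) atTop (𝓝 0) :=
    tendsto_pow_atTop_nhds_zero_of_lt_one ht0.le ht1
  have hlim0 : Tendsto (fun k : ℕ => P k) atTop (𝓝 0) := by
    have h := (hpow.const_mul ρ).div ((hpow.const_mul ρ).const_add 1) (by simp)
    simpa [P, Pi.div_def] using h
  have hlim1 : Tendsto (fun k : ℕ => P (-k)) atTop (𝓝 1) := by
    have h : Tendsto (fun k : ℕ => ρ / (t ^ k + ρ)) atTop (𝓝 (ρ / (0 + ρ))) :=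
      tendsto_const_nhds.div (hpow.add_const ρ) (by simpa using hρ0.ne')
    rw [zero_add, div_self hρ0.ne'] at h
    refine h.congr fun k => ?_
    have : 0 < t ^ k := by positivity
    simp only [P, zpow_neg, zpow_natCast]
    field_simp
  have hpos : HasSum (fun k : ℕ => P k - P (k + 1)) (P 0) := by
    rw [hasSum_iff_tendsto_nat_of_nonneg (fun k => sub_nonneg.mpr (hanti k))]
    have h : ∀ N : ℕ, ∑ k ∈ Finset.range N, (P k - P (k + 1)) = P 0 - P N := fun N => by
      have := Finset.sum_range_sub' (fun k : ℕ => P k) N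
      simpa using this
    simp only [h]
    simpa using hlim0.const_sub (P 0)
  have hneg : HasSum (fun k : ℕ => P (-(k + 1)) - P (-(k + 1) + 1)) (1 - P 0) := by
    rw [hasSum_iff_tendsto_nat_of_nonneg (fun k => sub_nonneg.mpr (hanti _))]
    have h : ∀ N : ℕ, ∑ k ∈ Finset.range N, (P (-(k + 1)) - P (-(k + 1) + 1)) =
        P (-N) - P 0 := fun N => by
      have := Finset.sum_range_sub (fun k : ℕ => P (-k)) N
      simpa using this
    simp only [h]
    exact hlim1.sub_const _
  have hall := HasSum.of_nat_of_neg_add_one (f := fun k : ℤ => P k - P (k + 1)) hpos hneg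
  rw [add_sub_cancel] at hall
  have h := hall.mul_left (1 / (a ^ 4 - b ^ 4))
  rw [mul_one] at h
  simpa only [hterm] using h

end UnitSum

section QuadraticField

variable {K : Type*} [Field K] [NumberField K]

lemma exists_realEmbedding_pair (hK : finrank ℚ K = 2) (σ : K →+* ℝ) :
    ∃ σ' : K →+* ℝ, σ' ≠ σ ∧ ∀ x : K, ((Algebra.norm ℚ x : ℚ) : ℝ) = σ x * σ' x := by
  classical
  have : Algebra.IsQuadraticExtension ℚ K := { finrank_eq_two' := hK }
  have hcard : Nat.card Gal(K/ℚ) = 2 := by rw [IsGalois.card_aut_eq_finrank, hK]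
  obtain ⟨τ, hτ⟩ : ∃ τ : Gal(K/ℚ), τ ≠ 1 := by
    have : Nontrivial Gal(K/ℚ) := Finite.one_lt_card_iff_nontrivial.mp (by omega)
    exact exists_ne 1
  refine ⟨σ.comp (τ : K →+* K), fun h => hτ ?_, fun x => ?_⟩
  · ext x
    exact σ.injective (RingHom.congr_fun h x)
  · have h := congrArg σ (Algebra.norm_eq_prod_automorphisms ℚ x)
    have huniv : (Finset.univ : Finset Gal(K/ℚ)) = {1, τ} := by
      symm
      apply Finset.eq_univ_of_card
      rw [Finset.card_pair hτ.symm, ← Nat.card_eq_fintype_card, hcard]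
    rw [huniv, Finset.prod_pair hτ.symm] at h
    have h2 : σ (algebraMap ℚ K (Algebra.norm ℚ x)) = ((Algebra.norm ℚ x : ℚ) : ℝ) := by
      rw [eq_ratCast, map_ratCast]
    rw [← h2, h, map_mul]
    rfl

lemma exists_rat_of_realEmbedding_eq (hK : finrank ℚ K = 2) {σ σ' : K →+* ℝ} (h : σ' ≠ σ)
    {x : K} (hx : σ x = σ' x) : ∃ r : ℚ, x = r := by
  have := Subalgebra.isSimpleOrder_of_finrank_prime ℚ K (hK ▸ Nat.prime_two)
  rcases eq_bot_or_eq_top (AlgHom.equalizer σ.toRatAlgHom σ'.toRatAlgHom) with h1 | h1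
  · have : x ∈ AlgHom.equalizer σ.toRatAlgHom σ'.toRatAlgHom := hx
    rw [h1] at this
    obtain ⟨r, hr⟩ := Algebra.mem_bot.mp this
    exact ⟨r, by rw [← hr, eq_ratCast]⟩
  · refine absurd (RingHom.ext fun y => ?_) h
    have : y ∈ AlgHom.equalizer σ.toRatAlgHom σ'.toRatAlgHom := h1 ▸ Algebra.mem_top
    exact this.symm

lemma infinitePlace_eq_or_eq (hK : finrank ℚ K = 2) {σ σ' : K →+* ℝ} (h : σ' ≠ σ) 
    (w : InfinitePlace K) : (∀ x, w x = |σ x|) ∨ (∀ x, w x = |σ' x|) := by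
  classical
  have hne : Complex.ofRealHom.comp σ ≠ Complex.ofRealHom.comp σ' := fun he => h (by
    ext x
    have := RingHom.congr_fun he x
    simpa using this.symm)
  have huniv : (Finset.univ : Finset (K →+* ℂ)) =
      {Complex.ofRealHom.comp σ, Complex.ofRealHom.comp σ'} := by
    symm
    apply Finset.eq_univ_of_card
    rw [Finset.card_pair hne, NumberField.Embeddings.card, hK]
  have hw : w.embedding ∈ (Finset.univ : Finset (K →+* ℂ)) := Finset.mem_univ _
  rw [huniv, Finset.mem_insert, Finset.mem_singleton] at hw
  refine hw.imp (fun hw x => ?_) (fun hw x => ?_) <;>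
  · rw [← InfinitePlace.norm_embedding_eq, hw]
    simp

lemma rank_eq_one (hK : finrank ℚ K = 2) (σ : K →+* ℝ) : NumberField.Units.rank K = 1 := by
  classical
  have h1 := InfinitePlace.card_eq_nrRealPlaces_add_nrComplexPlaces K
  have h2 := InfinitePlace.card_add_two_mul_card_eq_rank K
  have h3 : 0 < InfinitePlace.nrRealPlaces K := by
    refine Fintype.card_pos_iff.mpr ⟨⟨InfinitePlace.mk (Complex.ofRealHom.comp σ), ?_⟩⟩
    refine ⟨Complex.ofRealHom.comp σ, ?_, rfl⟩
    ext x
    simp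
  rw [NumberField.Units.rank, h1]
  omega

lemma exists_bijective_torsion_mul_zpow (hK : finrank ℚ K = 2) {σ σ' : K →+* ℝ} (h : σ' ≠ σ)
    (hN : ∀ x : K, ((Algebra.norm ℚ x : ℚ) : ℝ) = σ x * σ' x) :
    ∃ ε : (𝓞 K)ˣ, |σ' (ε : K)| < |σ (ε : K)| ∧ Function.Bijective
      (fun p : NumberField.Units.torsion K × ℤ => (p.1 : (𝓞 K)ˣ) * ε ^ p.2) := by
  have hr := rank_eq_one hK σ
  let i0 : Fin (NumberField.Units.rank K) := ⟨0, by omega⟩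
  have : Subsingleton (Fin (NumberField.Units.rank K)) := by rw [hr]; infer_instance
  set ε := NumberField.Units.fundSystem K i0
  have hex : ∀ x : (𝓞 K)ˣ, ∃! p : NumberField.Units.torsion K × ℤ, x = p.1 * ε ^ p.2 := by
    intro x
    obtain ⟨⟨ζ, e⟩, h1, h2⟩ := NumberField.Units.exist_unique_eq_mul_prod K x
    refine ⟨(ζ, e i0), ?_, ?_⟩
    · simpa only [Fintype.prod_subsingleton _ i0] using h1
    · rintro ⟨ζ', e'⟩ h'
      have := h2 (ζ', fun _ => e') (by simpa only [Fintype.prod_subsingleton _ i0] using h')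
      rw [Prod.mk.injEq] at this ⊢
      exact ⟨this.1, by rw [← this.2]⟩
  have hbij : Function.Bijective
      (fun p : NumberField.Units.torsion K × ℤ => (p.1 : (𝓞 K)ˣ) * ε ^ p.2) :=
    Function.bijective_iff_existsUnique _ |>.mpr fun x => by
      simpa only [eq_comm] using hex x
  have hnorm : ∀ u : (𝓞 K)ˣ, |σ (u : K)| * |σ' (u : K)| = 1 := fun u => by
    rw [← abs_mul, ← hN]
    have h1 := NumberField.Units.norm K u
    have h2 : |((Algebra.norm ℚ (u : K) : ℚ) : ℝ)| = ((|Algebra.norm ℚ (u : K)| : ℚ) : ℝ) := by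
      push_cast; rfl
    rw [h2, h1, Rat.cast_one]
  have hne : |σ (ε : K)| ≠ |σ' (ε : K)| := fun he => by
    have h1 := hnorm ε
    rw [← he] at h1
    have h2 : |σ (ε : K)| = 1 := by nlinarith [abs_nonneg (σ (ε : K))]
    have ht : ε ∈ NumberField.Units.torsion K := by
      rw [NumberField.Units.mem_torsion]
      intro w
      rcases infinitePlace_eq_or_eq hK h w with hw | hw
      · rw [hw, h2]
      · rw [hw, ← he, h2]
    have := @hbij.1 (⟨ε, ht⟩, 0) (1, 1) (by simp)
    simp at this
  rcases lt_or_gt_of_ne hne with hlt | hlt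
  · refine ⟨ε⁻¹, ?_, ?_⟩
    · have hc : ∀ ρ : K →+* ℝ, |ρ ((ε⁻¹ : (𝓞 K)ˣ) : K)| = |ρ (ε : K)|⁻¹ := fun ρ => by
        have : ((ε⁻¹ : (𝓞 K)ˣ) : K) = (ε : K)⁻¹ := by simp
        rw [this, map_inv₀, abs_inv]
      rw [hc, hc]
      exact inv_strictAnti₀ (abs_pos.mpr (by simp)) hlt
    · have : (fun p : NumberField.Units.torsion K × ℤ => (p.1 : (𝓞 K)ˣ) * ε⁻¹ ^ p.2) =
        (fun p : NumberField.Units.torsion K × ℤ => (p.1 : (𝓞 K)ˣ) * ε ^ p.2) ∘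
          (Equiv.prodCongr (Equiv.refl _) (Equiv.neg ℤ)) := by
        funext p; simp
      rw [this]
      exact hbij.comp (Equiv.bijective _)
  · exact ⟨ε, hlt, hbij⟩

end QuadraticField

section ClassLattice

variable {K : Type*} [Field K] [NumberField K]

lemma unitKernel_congr_abs {A B s : ℝ} {v v' : ℝ × ℝ} (h1 : |v.1| = |v'.1|) (h2 : |v.2| = |v'.2|) :
    unitKernel A B s v = unitKernel A B s v' := by
  have e : ∀ x y : ℝ, |x| = |y| → x ^ 4 = y ^ 4 := fun x y h => by
    rw [← Even.pow_abs (by decide) x, h, Even.pow_abs (by decide)]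
  rw [unitKernel, unitKernel, abs_mul, abs_mul, h1, h2, e _ _ h1, e _ _ h2]

lemma unitKernel_eq_rpow_mul (A B s : ℝ) {v : ℝ × ℝ} (h : v.1 * v.2 ≠ 0) :
    unitKernel A B s v = |v.1 * v.2| ^ (-s) * unitKernel A B 0 v := by
  rw [unitKernel, unitKernel, ← mul_div_assoc, ← Real.rpow_add (abs_pos.mpr h)]
  ring_nf

lemma hasSum_units_unitKernel {σ σ' : K →+* ℝ} {ε : (𝓞 K)ˣ}
    (hε : |σ' (ε : K)| < |σ (ε : K)|) (hbij : Function.Bijective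
      (fun p : NumberField.Units.torsion K × ℤ => (p.1 : (𝓞 K)ˣ) * ε ^ p.2)) {x : K} (hx : x ≠ 0) :
    HasSum (fun u : (𝓞 K)ˣ =>
        unitKernel (σ (ε : K) ^ 4) (σ' (ε : K) ^ 4) 0 (σ ((u : K) * x), σ' ((u : K) * x)))
      (Nat.card (NumberField.Units.torsion K) * (1 / (σ (ε : K) ^ 4 - σ' (ε : K) ^ 4))) := by
  have hε0 : σ' (ε : K) ≠ 0 := by simp
  have hσ : σ x ≠ 0 := by simpa using hx
  have hσ' : σ' x ≠ 0 := by simpa using hx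
  have hZ := hasSum_int_unitKernel_zero hε0 hε (v := (σ x, σ' x)) hσ hσ'
  rw [← (Equiv.ofBijective _ hbij).hasSum_iff]
  have htors : ∀ (ρ : K →+* ℝ) (ζ : NumberField.Units.torsion K), |ρ ((ζ : (𝓞 K)ˣ) : K)| = 1 := by
    intro ρ ζ
    have h := NumberField.Units.mem_torsion K |>.mp ζ.2
      (InfinitePlace.mk (Complex.ofRealHom.comp ρ))
    simpa using h
  have hf : ∀ p : NumberField.Units.torsion K × ℤ,
      ((fun u : (𝓞 K)ˣ => unitKernel (σ (ε : K) ^ 4) (σ' (ε : K) ^ 4) 0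
        (σ ((u : K) * x), σ' ((u : K) * x))) ∘ Equiv.ofBijective _ hbij) p =
      unitKernel (σ (ε : K) ^ 4) (σ' (ε : K) ^ 4) 0
        (σ (ε : K) ^ p.2 * σ x, σ' (ε : K) ^ p.2 * σ' x) := by
    intro p
    apply unitKernel_congr_abs <;>
    · simp [abs_mul, htors, NumberField.Units.coe_zpow]
  rw [funext hf]
  have hnn : (0 : NumberField.Units.torsion K × ℤ → ℝ) ≤ fun p => unitKernel (σ (ε : K) ^ 4)
      (σ' (ε : K) ^ 4) 0 (σ (ε : K) ^ p.2 * σ x, σ' (ε : K) ^ p.2 * σ' x) := fun p => by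
    simp only [Pi.zero_apply]
    unfold unitKernel
    positivity
  have hs := (summable_prod_of_nonneg hnn).mpr ⟨fun _ => hZ.summable, Summable.of_finite⟩
  have h := hs.hasSum
  rw [hs.tsum_prod] at h
  simp only [hZ.tsum_eq, tsum_const, nsmul_eq_mul] at h
  exact h

lemma exists_det_ne_zero (hK : finrank ℚ K = 2) {σ σ' : K →+* ℝ} (h : σ' ≠ σ) {β : Fin 2 → 𝓞 K}
    (hβ : ∀ x : Fin 2 → ℤ, x 0 * β 0 + x 1 * β 1 = 0 → x = 0) :
    σ (β 0) * σ' (β 1) - σ (β 1) * σ' (β 0) ≠ 0 := by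
  intro hdet
  have h1 : β 1 ≠ 0 := fun h1 => by
    have := congrFun (hβ ![0, 1] (by simp [h1])) 1
    simp at this
  have h1K : (β 1 : K) ≠ 0 := by simpa using h1
  have e1 : σ (β 1) ≠ 0 := by simpa using h1
  have e2 : σ' (β 1) ≠ 0 := by simpa using h1
  obtain ⟨r, hr⟩ := exists_rat_of_realEmbedding_eq hK h (x := (β 0 : K) / β 1) (by
    rw [map_div₀, map_div₀, div_eq_div_iff e1 e2]
    linarith)
  rw [div_eq_iff h1K] at hr
  have h2 := congrFun (hβ ![r.den, -r.num] (by
    apply RingOfIntegers.coe_injective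
    have hd : (r.den : K) ≠ 0 := by exact_mod_cast r.den_ne_zero
    have : (r : K) = r.num / r.den := by exact_mod_cast (Rat.num_div_den r).symm
    simp only [Matrix.cons_val_zero, Matrix.cons_val_one, map_add, map_mul, map_zero]
    rw [show algebraMap (𝓞 K) K (β 0) = (β 0 : K) from rfl,
      show algebraMap (𝓞 K) K (β 1) = (β 1 : K) from rfl, hr, this]
    push_cast
    simp
    field_simp
    ring)) 0
  simp at h2

lemma exists_mul_norm_le {p q r t : ℝ} (h : p * t - q * r ≠ 0) :
    ∃ c : ℝ, 0 < c ∧ c ≤ 1 ∧ ∀ x : Fin 2 → ℤ,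
      c * ‖x‖ ≤ ‖((x 0 * p + x 1 * q, x 0 * r + x 1 * t) : ℝ × ℝ)‖ := by
  set M : ℝ := |p| + |q| + |r| + |t| + |p * t - q * r|
  have hdet : 0 < |p * t - q * r| := abs_pos.mpr h
  have hM0 : 0 < M := by positivity
  refine ⟨|p * t - q * r| / M, by positivity, (div_le_one hM0).mpr ?_, fun x => ?_⟩
  · have := abs_nonneg p; have := abs_nonneg q; have := abs_nonneg r; have := abs_nonneg t
    linarith
  · set V : ℝ := ‖((x 0 * p + x 1 * q, x 0 * r + x 1 * t) : ℝ × ℝ)‖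
    have hV1 : |(x 0 * p + x 1 * q : ℝ)| ≤ V :=
      norm_fst_le ((x 0 * p + x 1 * q, x 0 * r + x 1 * t) : ℝ × ℝ)
    have hV2 : |(x 0 * r + x 1 * t : ℝ)| ≤ V :=
      norm_snd_le ((x 0 * p + x 1 * q, x 0 * r + x 1 * t) : ℝ × ℝ)
    have hV0 : 0 ≤ V := norm_nonneg _
    rw [div_mul_eq_mul_div, div_le_iff₀ hM0]
    have key : ∀ i, |p * t - q * r| * ‖x i‖ ≤ V * M := by
      have hcomb : ∀ y z : ℝ, |y| + |z| ≤ M →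
          |(x 0 * p + x 1 * q) * y - (x 0 * r + x 1 * t) * z| ≤ V * M := fun y z hyz => by
        refine (abs_sub _ _).trans ?_
        rw [abs_mul, abs_mul]
        have e1 := mul_le_mul_of_nonneg_right hV1 (abs_nonneg y)
        have e2 := mul_le_mul_of_nonneg_right hV2 (abs_nonneg z)
        have e3 := mul_le_mul_of_nonneg_left hyz hV0
        linarith
      have := abs_nonneg p; have := abs_nonneg q; have := abs_nonneg r; have := abs_nonneg t
      intro i
      rw [Int.norm_eq_abs, ← abs_mul]
      fin_cases i
      · refine le_of_eq_of_le (congrArg _ ?_) (hcomb t q (by linarith))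
        simp only [Fin.zero_eta]
        ring
      · refine le_of_eq_of_le ?_ (hcomb r p (by linarith))
        rw [← abs_neg]
        congr 1
        simp only [Fin.mk_one]
        ring
    have hx : ‖x‖ ≤ V * M / |p * t - q * r| := by
      refine (pi_norm_le_iff_of_nonneg (by positivity)).mpr fun i => ?_
      rw [le_div_iff₀ hdet, mul_comm]
      exact key i
    rw [le_div_iff₀ hdet] at hx
    linarith

lemma exists_norm_eq_quadraticForm {σ σ' : K →+* ℝ}
    (hN : ∀ x : K, ((Algebra.norm ℚ x : ℚ) : ℝ) = σ x * σ' x) {J : Ideal (𝓞 K)} 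
    {β : Fin 2 → 𝓞 K} (hβ : ∀ i, β i ∈ J) :
    ∃ P Q R : ℤ, ∀ x : Fin 2 → ℤ, Algebra.norm ℤ ((x 0 : 𝓞 K) * β 0 + x 1 * β 1) =
      Ideal.absNorm J * (P * x 0 ^ 2 + Q * (x 0 * x 1) + R * x 1 ^ 2) := by
  have hNZ : ∀ y : 𝓞 K, ((Algebra.norm ℤ y : ℤ) : ℝ) = σ y * σ' y := fun y => by
    rw [← hN, ← Algebra.coe_norm_int]
    norm_cast
  obtain ⟨P, hP⟩ := Ideal.absNorm_dvd_norm_of_mem (hβ 0)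
  obtain ⟨R, hR⟩ := Ideal.absNorm_dvd_norm_of_mem (hβ 1)
  obtain ⟨Q, hQ⟩ := Ideal.absNorm_dvd_norm_of_mem (J.add_mem (hβ 0) (hβ 1))
  refine ⟨P, Q - P - R, R, fun x => ?_⟩
  have hP' := congrArg (Int.cast : ℤ → ℝ) hP
  have hR' := congrArg (Int.cast : ℤ → ℝ) hR
  have hQ' := congrArg (Int.cast : ℤ → ℝ) hQ
  rw [hNZ] at hP' hR' hQ'
  have : ((Algebra.norm ℤ ((x 0 : 𝓞 K) * β 0 + x 1 * β 1) : ℤ) : ℝ) =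
      ((Ideal.absNorm J * (P * x 0 ^ 2 + (Q - P - R) * (x 0 * x 1) + R * x 1 ^ 2) : ℤ) : ℝ) := by
    rw [hNZ]
    push_cast at hP' hR' hQ' ⊢
    simp only [map_add, map_mul, map_intCast] at hP' hR' hQ' ⊢
    linear_combination (x 0 : ℝ) ^ 2 * hP' + (x 1 : ℝ) ^ 2 * hR' +
      (x 0 * x 1 : ℝ) * (hQ' - hP' - hR')
  exact_mod_cast this

end ClassLattice

section ClassLattice

variable {K : Type*} [Field K] [NumberField K]

lemma exists_fin_two_spanning (hK : finrank ℚ K = 2) {J : Ideal (𝓞 K)} (hJ : J ≠ ⊥) :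
    ∃ β : Fin 2 → 𝓞 K, (∀ i, β i ∈ J) ∧ (∀ x : Fin 2 → ℤ, x 0 * β 0 + x 1 * β 1 = 0 → x = 0) ∧
      ∀ a ∈ J, ∃ x : Fin 2 → ℤ, x 0 * β 0 + x 1 * β 1 = a := by
  let b := Ideal.selfBasis (Module.finBasisOfFinrankEq ℤ (𝓞 K)
    ((RingOfIntegers.rank K).trans hK)) J hJ
  have hb : ∀ x : Fin 2 → ℤ, ((∑ i, x i • b i : J) : 𝓞 K) = x 0 * (b 0 : 𝓞 K) + x 1 * (b 1 : 𝓞 K) :=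
    fun x => by simp [Fin.sum_univ_two]
  refine ⟨fun i => b i, fun i => (b i).2, fun x hx => ?_, fun a ha => ?_⟩
  · rw [← hb] at hx
    have h := Fintype.linearIndependent_iff.mp b.linearIndependent x (Subtype.ext hx)
    exact funext h
  · refine ⟨b.repr ⟨a, ha⟩, ?_⟩
    rw [← hb, b.sum_repr]

lemma exists_span_singleton_eq_mul {c : ClassGroup (𝓞 K)} {J : (Ideal (𝓞 K))⁰}
    (hJ : ClassGroup.mk0 J = c⁻¹) :
    ∃ g : {x : 𝓞 K // x ∈ (J : Ideal (𝓞 K)) ∧ x ≠ 0} →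
        {a : (Ideal (𝓞 K))⁰ // ClassGroup.mk0 a = c},
      (∀ x, Ideal.span {x.1} = (J : Ideal (𝓞 K)) * (g x).1) ∧ Function.Surjective g ∧
        ∀ x x', g x = g x' ↔ Associated x.1 x'.1 := by
  have hJ0 : (J : Ideal (𝓞 K)) ≠ 0 := nonZeroDivisors.coe_ne_zero J
  have hex : ∀ x : {x : 𝓞 K // x ∈ (J : Ideal (𝓞 K)) ∧ x ≠ 0},
      ∃ a : {a : (Ideal (𝓞 K))⁰ // ClassGroup.mk0 a = c},
        Ideal.span {x.1} = (J : Ideal (𝓞 K)) * a.1 := by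
    rintro ⟨x, hx, hx0⟩
    obtain ⟨I, hI⟩ := Ideal.dvd_iff_le.mpr ((Ideal.span_singleton_le_iff_mem _).mpr hx)
    have hI0 : I ≠ 0 := by
      rintro rfl
      rw [mul_zero, Ideal.zero_eq_bot, Ideal.span_singleton_eq_bot] at hI
      exact hx0 hI
    refine ⟨⟨⟨I, mem_nonZeroDivisors_of_ne_zero hI0⟩, ?_⟩, hI⟩
    have h1 : ClassGroup.mk0 (J * ⟨I, mem_nonZeroDivisors_of_ne_zero hI0⟩) = 1 := by
      rw [ClassGroup.mk0_eq_one_iff]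
      exact ⟨⟨x, hI.symm⟩⟩
    rw [map_mul, hJ, inv_mul_eq_one] at h1
    exact h1.symm
  choose g hg using hex
  have hcancel : ∀ a b : {a : (Ideal (𝓞 K))⁰ // ClassGroup.mk0 a = c},
      (J : Ideal (𝓞 K)) * a.1 = (J : Ideal (𝓞 K)) * b.1 → a = b := fun a b h =>
    Subtype.ext (Subtype.ext (mul_left_cancel₀ hJ0 h))
  refine ⟨g, hg, fun a => ?_, fun x x' => ?_⟩
  · have h1 : ClassGroup.mk0 (J * a.1) = 1 := by rw [map_mul, hJ, a.2, inv_mul_cancel]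
    rw [ClassGroup.mk0_eq_one_iff] at h1
    obtain ⟨y, hy⟩ := h1.principal
    have hy' : (J : Ideal (𝓞 K)) * a.1 = Ideal.span {y} := hy
    have hyJ : y ∈ (J : Ideal (𝓞 K)) := by
      have : y ∈ (J : Ideal (𝓞 K)) * a.1 := by
        rw [hy']
        exact Ideal.mem_span_singleton_self y
      have hle : (J : Ideal (𝓞 K)) * a.1 ≤ J := Ideal.mul_le_left
      exact hle this
    have hy0 : y ≠ 0 := by
      rintro rfl
      rw [Ideal.span_singleton_eq_bot.mpr rfl] at hy'
      exact nonZeroDivisors.coe_ne_zero (J * a.1) hy'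
    exact ⟨⟨y, hyJ, hy0⟩, hcancel _ _ (by rw [← hg, hy'])⟩
  · rw [← Ideal.span_singleton_eq_span_singleton, hg, hg]
    exact ⟨fun h => by rw [h], hcancel _ _⟩

lemma hasSum_fiber_of_hasSum_units {J : Ideal (𝓞 K)} {Y : Type*}
    {g : {x : 𝓞 K // x ∈ J ∧ x ≠ 0} → Y} (hg : Function.Surjective g)
    (hassoc : ∀ x x', g x = g x' ↔ Associated x.1 x'.1) {h : 𝓞 K → ℝ} {c : ℝ}
    (hc : ∀ x : 𝓞 K, x ≠ 0 → HasSum (fun u : (𝓞 K)ˣ => h (u * x)) c) (y : Y) :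
    HasSum (fun x : {x // g x = y} => h x.1.1) c := by
  obtain ⟨⟨x0, hx0J, hx0⟩, rfl⟩ := hg y
  let φ : (𝓞 K)ˣ → {x // g x = g ⟨x0, hx0J, hx0⟩} := fun u =>
    ⟨⟨u * x0, Ideal.mul_mem_left _ _ hx0J, mul_ne_zero u.ne_zero hx0⟩,
      (hassoc _ _).mpr (associated_unit_mul_left x0 u u.isUnit)⟩
  have hφ : Function.Bijective φ := by
    constructor
    · intro u u' h
      have h1 : (u : 𝓞 K) * x0 = u' * x0 := congrArg (fun z => z.1.1) h
      exact Units.ext (mul_right_cancel₀ hx0 h1)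
    · rintro ⟨⟨x, hxJ, hx⟩, hxg⟩
      obtain ⟨u, hu⟩ := ((hassoc _ _).mp hxg).symm
      refine ⟨u, Subtype.ext (Subtype.ext ?_)⟩
      rw [← hu, mul_comm]
  rw [← (Equiv.ofBijective φ hφ).hasSum_iff]
  exact hc x0 hx0

lemma sum_dirichletCharacter_quadraticForm {n : ℕ} [NeZero n] {θ : DirichletCharacter ℂ n}
    (hθ : θ ^ 2 ≠ 1) (P Q R : ZMod n) :
    ∑ z : Fin 2 → ZMod n, θ (P * z 0 ^ 2 + Q * (z 0 * z 1) + R * z 1 ^ 2) = 0 := by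
  obtain ⟨k, hk⟩ := MulChar.ne_one_iff.mp hθ
  have h := Fintype.sum_bijective (fun z : Fin 2 → ZMod n => k • z) (MulAction.bijective k)
    (fun z => θ k ^ 2 * θ (P * z 0 ^ 2 + Q * (z 0 * z 1) + R * z 1 ^ 2))
    (fun z => θ (P * z 0 ^ 2 + Q * (z 0 * z 1) + R * z 1 ^ 2)) fun z => by
      rw [← map_pow, ← map_mul]
      congr 1
      simp only [Pi.smul_apply, Units.smul_def, smul_eq_mul]
      ring
  rw [← Finset.mul_sum] at h
  rw [MulChar.pow_apply_coe] at hk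
  have h2 : (θ k ^ 2 - 1) * ∑ z : Fin 2 → ZMod n,
      θ (P * z 0 ^ 2 + Q * (z 0 * z 1) + R * z 1 ^ 2) = 0 := by rw [sub_mul, h, one_mul, sub_self]
  exact (mul_eq_zero.mp h2).resolve_left (sub_ne_zero.mpr hk)

end ClassLattice

section ClassLattice

variable {K : Type*} [Field K] [NumberField K]

lemma tsum_eq_tsum_fiber_mul {X Y Z : Type*} [Zero X] {G : X → ℂ} (hG : Summable G) (hG0 : G 0 = 0)
    {e : {x : X // x ≠ 0} → Z} (he : Function.Bijective e) (g : Z → Y) (F : Y → ℂ) (k : Z → ℝ)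
    (d : ℂ) {c : ℝ} (hterm : ∀ x, G (x : {x : X // x ≠ 0}).1 = F (g (e x)) * (d * (k (e x) : ℂ)))
    (hk : ∀ y, HasSum (fun z : {z // g z = y} => k z.1) c) :
    ∑' x, G x = (∑' y, F y) * (d * (c : ℂ)) := by
  have h1 : HasSum (fun x : {x : X // x ≠ 0} => G x.1) (∑' x, G x) := by
    refine (hasSum_subtype_iff_of_support_subset (s := {x : X | x ≠ 0}) (f := G) ?_).mpr hG.hasSum
    intro x hx hx0
    exact hx (by rw [hx0, hG0])
  rw [funext hterm] at h1
  have h2 := ((Equiv.ofBijective e he).hasSum_iff (f := fun z => F (g z) * (d * (k z : ℂ)))).mp h1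
  have h3 := ((Equiv.sigmaFiberEquiv g).hasSum_iff.mpr h2).sigma (g := fun y => F y * (d * (c : ℂ)))
    fun y => by
      have h4 := (Complex.hasSum_ofReal.mpr (hk y)).mul_left (F y * d)
      rw [mul_assoc] at h4
      refine h4.congr_fun fun x => ?_
      simp only [Function.comp_apply, Equiv.sigmaFiberEquiv_apply, x.2, mul_assoc]
  rw [← h3.tsum_eq, tsum_mul_right]

set_option maxHeartbeats 1600000 in
lemma exists_norm_tsum_class_le (hK : finrank ℚ K = 2) (σ : K →+* ℝ) {n : ℕ} [NeZero n]
    (θ : DirichletCharacter ℂ n) (hθ1 : θ (-1) = 1) (hθ : θ ^ 2 ≠ 1) (c : ClassGroup (𝓞 K)) :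
    ∃ C : ℝ, ∀ s : ℝ, 1 < s → s ≤ 2 →
      ‖∑' a : {a : (Ideal (𝓞 K))⁰ // ClassGroup.mk0 a = c},
        θ (Ideal.absNorm (a.1 : Ideal (𝓞 K)) : ℕ) *
          ((Ideal.absNorm (a.1 : Ideal (𝓞 K)) : ℝ) ^ (-s) : ℝ)‖ ≤ C := by
  obtain ⟨σ', hne, hN⟩ := exists_realEmbedding_pair hK σ
  have hNZ : ∀ y : 𝓞 K, ((Algebra.norm ℤ y : ℤ) : ℝ) = σ y * σ' y := fun y => by
    rw [← hN, ← Algebra.coe_norm_int]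
    norm_cast
  obtain ⟨ε, hε, hbij⟩ := exists_bijective_torsion_mul_zpow hK hne hN
  obtain ⟨J, hJ⟩ := ClassGroup.mk0_surjective c⁻¹
  have hJ0 : (J : Ideal (𝓞 K)) ≠ ⊥ := nonZeroDivisors.coe_ne_zero J
  obtain ⟨β, hβJ, hβ0, hβs⟩ := exists_fin_two_spanning hK hJ0
  obtain ⟨P, Q, R, hq⟩ := exists_norm_eq_quadraticForm hN hβJ
  obtain ⟨g, hg, hgs, hga⟩ := exists_span_singleton_eq_mul hJ
  let α : (Fin 2 → ℤ) →+ 𝓞 K := AddMonoidHom.mk' (fun x => (x 0 : 𝓞 K) * β 0 + x 1 * β 1)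
    (fun x y => by simp only [Pi.add_apply]; push_cast; ring)
  have hα0 : ∀ x, α x = 0 → x = 0 := hβ0
  have hαJ : ∀ x, α x ∈ (J : Ideal (𝓞 K)) := fun x =>
    Ideal.add_mem _ (Ideal.mul_mem_left _ _ (hβJ 0)) (Ideal.mul_mem_left _ _ (hβJ 1))
  let V : 𝓞 K →+ ℝ × ℝ := AddMonoidHom.mk' (fun y => (σ (y : K), σ' (y : K)))
    (fun x y => by simp)
  obtain ⟨δ, hδ0, hδ1, hδ⟩ := exists_mul_norm_le (exists_det_ne_zero hK hne hβ0)
  have hvδ : ∀ x, δ * ‖x‖ ≤ ‖V.comp α x‖ := fun x => by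
    refine (hδ x).trans (le_of_eq (congrArg norm ?_))
    simp [V, α]
  let e : {x : Fin 2 → ℤ // x ≠ 0} → {x : 𝓞 K // x ∈ (J : Ideal (𝓞 K)) ∧ x ≠ 0} :=
    fun x => ⟨α x.1, hαJ x.1, fun h => x.2 (hα0 _ h)⟩
  have he : Function.Bijective e := by
    constructor
    · intro x y h
      exact Subtype.ext ((injective_iff_map_eq_zero α).mpr hα0 (congrArg Subtype.val h))
    · rintro ⟨y, hyJ, hy0⟩
      obtain ⟨x, hx⟩ := hβs y hyJ
      refine ⟨⟨x, ?_⟩, Subtype.ext hx⟩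
      rintro rfl
      exact hy0 (by rw [← hx]; simp)
  let NJ : ℕ := Ideal.absNorm (J : Ideal (𝓞 K))
  have hNJ0 : 0 < NJ := Nat.pos_of_ne_zero (by rwa [Ne, Ideal.absNorm_eq_zero_iff])
  let w : (Fin 2 → ZMod n) → ℂ := fun z => θ (P * z 0 ^ 2 + Q * (z 0 * z 1) + R * z 1 ^ 2)
  have hw1 : ∀ z, ‖w z‖ ≤ 1 := fun z => DirichletCharacter.norm_le_one _ _
  have hA : 0 < σ (ε : K) ^ 4 := by
    have : σ (ε : K) ≠ 0 := by simp
    positivity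
  have hB : 0 < σ' (ε : K) ^ 4 := by
    have : σ' (ε : K) ≠ 0 := by simp
    positivity
  have hAB : σ' (ε : K) ^ 4 < σ (ε : K) ^ 4 := by
    have := pow_lt_pow_left₀ hε (abs_nonneg _) (n := 4) (by norm_num)
    rwa [Even.pow_abs (by decide), Even.pow_abs (by decide)] at this
  have hunit : ∀ x : 𝓞 K, x ≠ 0 → HasSum (fun u : (𝓞 K)ˣ =>
      unitKernel (σ (ε : K) ^ 4) (σ' (ε : K) ^ 4) 0 (V (u * x)))
      (Nat.card (NumberField.Units.torsion K) * (1 / (σ (ε : K) ^ 4 - σ' (ε : K) ^ 4))) := by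
    intro x hx
    have hxK : (x : K) ≠ 0 := by simpa using hx
    have h := hasSum_units_unitKernel hε hbij hxK
    simpa [V] using h
  obtain ⟨C, hC⟩ := exists_norm_tsum_unitKernel_le w hw1
    (sum_dirichletCharacter_quadraticForm hθ _ _ _) (V.comp α) hδ0 hδ1 hvδ hA hB
  have hc0 : 0 < Nat.card (NumberField.Units.torsion K) *
      (1 / (σ (ε : K) ^ 4 - σ' (ε : K) ^ 4)) := mul_pos (by exact_mod_cast Nat.card_pos)
    (one_div_pos.mpr (sub_pos.mpr hAB))
  generalize σ (ε : K) ^ 4 = A at *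
  generalize σ' (ε : K) ^ 4 = B at *
  generalize Nat.card (NumberField.Units.torsion K) * (1 / (A - B)) = c0 at *
  have habs : ∀ x, Ideal.absNorm (Ideal.span {x.1}) = NJ * Ideal.absNorm ((g x).1 : Ideal (𝓞 K)) :=
    fun x => by rw [hg, map_mul]
  have hnormV : ∀ x, |(V x.1).1 * (V x.1).2| = NJ * Ideal.absNorm ((g x).1 : Ideal (𝓞 K)) := by
    intro x
    have h1 : (V x.1).1 * (V x.1).2 = ((Algebra.norm ℤ x.1 : ℤ) : ℝ) := (hNZ x.1).symm
    have h2 := habs x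
    rw [Ideal.absNorm_span_singleton] at h2
    rw [h1, ← Nat.cast_mul, ← h2, Nat.cast_natAbs, Int.cast_abs]
  have hθN : ∀ x, w (fun i => ((x : {x : Fin 2 → ℤ // x ≠ 0}).1 i : ZMod n)) =
      θ (Ideal.absNorm ((g (e x)).1 : Ideal (𝓞 K)) : ℕ) := by
    intro x
    have h2 := habs (e x)
    have h3 : Algebra.norm ℤ (e x).1 = _ := hq x.1
    rw [Ideal.absNorm_span_singleton, h3, Int.natAbs_mul, Int.natAbs_natCast] at h2
    have h4 := Nat.eq_of_mul_eq_mul_left hNJ0 h2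
    rw [← h4]
    have hw : w (fun i => (x.1 i : ZMod n)) =
        θ ((P * x.1 0 ^ 2 + Q * (x.1 0 * x.1 1) + R * x.1 1 ^ 2 : ℤ) : ZMod n) := by
      simp only [w]
      push_cast
      rfl
    rw [hw]
    generalize (P * x.1 0 ^ 2 + Q * (x.1 0 * x.1 1) + R * x.1 1 ^ 2 : ℤ) = k
    rcases Int.natAbs_eq k with hk | hk
    · have : (k : ZMod n) = (k.natAbs : ZMod n) := by rw [← Int.cast_natCast, ← hk]
      rw [this]
    · have : (k : ZMod n) = -1 * (k.natAbs : ZMod n) := by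
        rw [← Int.cast_natCast, neg_one_mul, ← Int.cast_neg, ← hk]
      rw [this, map_mul, hθ1, one_mul]
  clear_value w
  refine ⟨(NJ : ℝ) ^ (2 : ℝ) * C / c0, fun s hs hs' => ?_⟩
  obtain ⟨hsum, hle⟩ := hC s hs hs'
  have h5 := tsum_eq_tsum_fiber_mul
    (G := fun x : Fin 2 → ℤ => w (fun i => x i) * (unitKernel A B s (V.comp α x) : ℂ))
    (Summable.of_norm_bounded hsum.abs fun x => by
      rw [norm_mul, Complex.norm_real]
      exact mul_le_of_le_one_left (norm_nonneg _) (hw1 fun i => (x i : ZMod n)))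
    (by rw [map_zero, unitKernel_zero, Complex.ofReal_zero, mul_zero]) he g
    (fun a => θ (Ideal.absNorm (a.1 : Ideal (𝓞 K)) : ℕ) *
      ((Ideal.absNorm (a.1 : Ideal (𝓞 K)) : ℝ) ^ (-s) : ℝ))
    (fun z => unitKernel A B 0 (V z.1)) (((NJ : ℝ) ^ (-s) : ℝ) : ℂ) (c := c0)
    (fun x => by
      have hN0 : (Ideal.absNorm ((g (e x)).1 : Ideal (𝓞 K)) : ℝ) ≠ 0 :=
        Nat.cast_ne_zero.mpr (by
          rw [Ne, Ideal.absNorm_eq_zero_iff]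
          exact nonZeroDivisors.coe_ne_zero _)
      have hne0 : (V (e x).1).1 * (V (e x).1).2 ≠ 0 := by
        rw [← abs_ne_zero, hnormV]
        positivity
      have h1 := unitKernel_eq_rpow_mul A B s hne0
      rw [hnormV, Real.mul_rpow (by positivity) (by positivity)] at h1
      have h2 : V.comp α x.1 = V (e x).1 := rfl
      rw [h2, hθN, h1]
      push_cast
      ring)
    (hasSum_fiber_of_hasSum_units (h := fun x => unitKernel A B 0 (V x)) hgs hga hunit)
  have hNJs : (0 : ℝ) < (NJ : ℝ) ^ (-s) := by positivity
  rw [h5, norm_mul, norm_mul, Complex.norm_real, Complex.norm_real, Real.norm_of_nonneg hNJs.le,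
    Real.norm_of_nonneg hc0.le] at hle
  have hF0 := norm_nonneg (∑' a : {a : (Ideal (𝓞 K))⁰ // ClassGroup.mk0 a = c},
    θ (Ideal.absNorm (a.1 : Ideal (𝓞 K)) : ℕ) *
      ((Ideal.absNorm (a.1 : Ideal (𝓞 K)) : ℝ) ^ (-s) : ℝ))
  revert hle hF0
  generalize ‖∑' a : {a : (Ideal (𝓞 K))⁰ // ClassGroup.mk0 a = c},
    θ (Ideal.absNorm (a.1 : Ideal (𝓞 K)) : ℕ) *
      ((Ideal.absNorm (a.1 : Ideal (𝓞 K)) : ℝ) ^ (-s) : ℝ)‖ = N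
  intro hle hF0
  rw [le_div_iff₀ hc0]
  have hC0 : 0 ≤ C := le_trans (by positivity) hle
  calc N * c0 = (NJ : ℝ) ^ s * (N * ((NJ : ℝ) ^ (-s) * c0)) := by
        rw [Real.rpow_neg (by positivity)]
        field_simp
    _ ≤ (NJ : ℝ) ^ s * C := mul_le_mul_of_nonneg_left hle (by positivity)
    _ ≤ (NJ : ℝ) ^ (2 : ℝ) * C := by
        refine mul_le_mul_of_nonneg_right ?_ hC0
        exact Real.rpow_le_rpow_of_exponent_le (by exact_mod_cast hNJ0) hs'

end ClassLattice

section PrimeSums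

variable {K : Type*} [Field K] [NumberField K]

lemma two_le_absNorm_primeIdeal (v : HeightOneSpectrum (𝓞 K)) :
    2 ≤ Ideal.absNorm (primeIdeal v : Ideal (𝓞 K)) := by
  have h0 := absNorm_coe_ne_zero K (primeIdeal v)
  have h1 : Ideal.absNorm (primeIdeal v : Ideal (𝓞 K)) ≠ 1 := fun h =>
    v.isPrime.ne_top (Ideal.absNorm_eq_one_iff.mp h)
  omega

lemma coprime_absNorm_primeIdeal {v : HeightOneSpectrum (𝓞 K)} {n : ℕ}
    (hn : (n : 𝓞 K) ∉ v.asIdeal) :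
    Nat.Coprime (Ideal.absNorm (primeIdeal v : Ideal (𝓞 K))) n := by
  refine Nat.coprime_of_dvd fun p hp hpv hpn => hn ?_
  have := Fact.mk hp
  have hfin : Finite (𝓞 K ⧸ v.asIdeal) := Ideal.finiteQuotientOfFreeOfNeBot _ v.ne_bot
  obtain ⟨x, hx⟩ := exists_prime_addOrderOf_dvd_card' (G := 𝓞 K ⧸ v.asIdeal) p
    (by rwa [← Submodule.cardQuot_apply, ← Ideal.absNorm_apply])
  have hx0 : x ≠ 0 := fun h => hp.one_lt.ne' (by rw [← hx, h, addOrderOf_zero])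
  have hpx : (p : 𝓞 K ⧸ v.asIdeal) * x = 0 := by
    rw [← nsmul_eq_mul, ← hx, addOrderOf_nsmul_eq_zero]
  have hp0 : (p : 𝓞 K) ∈ v.asIdeal := by
    rw [← Ideal.Quotient.eq_zero_iff_mem, map_natCast]
    exact (mul_eq_zero.mp hpx).resolve_right hx0
  obtain ⟨m, rfl⟩ := hpn
  rw [Nat.cast_mul]
  exact Ideal.mul_mem_right _ _ hp0

lemma summable_absNorm_primeIdeal_rpow (K : Type*) [Field K] [NumberField K] {s : ℝ} (hs : 1 < s) :
    Summable fun v : HeightOneSpectrum (𝓞 K) =>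
      (Ideal.absNorm (primeIdeal v : Ideal (𝓞 K)) : ℝ) ^ (-s) :=
  (summable_absNorm_rpow K hs).comp_injective primeIdeal_injective

lemma exists_abs_log_norm_tsum_sub_le (u : (Ideal (𝓞 K))⁰ →* ℂ) (hu : ∀ a, ‖u a‖ ≤ 1) :
    ∃ C : ℝ, ∀ s : ℝ, 1 < s →
      (∑' a, u a * ((Ideal.absNorm (a : Ideal (𝓞 K)) : ℝ) ^ (-s) : ℝ)) ≠ 0 ∧
      |Real.log ‖∑' a, u a * ((Ideal.absNorm (a : Ideal (𝓞 K)) : ℝ) ^ (-s) : ℝ)‖ -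
        ∑' v, (u (primeIdeal v)).re *
          (Ideal.absNorm (primeIdeal v : Ideal (𝓞 K)) : ℝ) ^ (-s)| ≤ C := by
  refine ⟨∑' v : HeightOneSpectrum (𝓞 K),
    (Ideal.absNorm (primeIdeal v : Ideal (𝓞 K)) : ℝ) ^ (-2 : ℝ), fun s hs => ?_⟩
  let f : (Ideal (𝓞 K))⁰ →* ℂ :=
    { toFun := fun a => u a * ((Ideal.absNorm (a : Ideal (𝓞 K)) : ℝ) ^ (-s) : ℝ)
      map_one' := by simp
      map_mul' := fun a b => by
        rw [map_mul, Submonoid.coe_mul, map_mul, Nat.cast_mul,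
          Real.mul_rpow (by positivity) (by positivity)]
        push_cast
        ring }
  have hfle : ∀ a, ‖f a‖ ≤ (Ideal.absNorm (a : Ideal (𝓞 K)) : ℝ) ^ (-s) := fun a => by
    change ‖u a * _‖ ≤ _
    rw [norm_mul, Complex.norm_real, Real.norm_of_nonneg (by positivity)]
    exact mul_le_of_le_one_left (by positivity) (hu a)
  have hN : ∀ v : HeightOneSpectrum (𝓞 K),
      (2 : ℝ) ≤ Ideal.absNorm (primeIdeal v : Ideal (𝓞 K)) := fun v => by
    exact_mod_cast two_le_absNorm_primeIdeal v
  have hNs : ∀ v : HeightOneSpectrum (𝓞 K),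
      (Ideal.absNorm (primeIdeal v : Ideal (𝓞 K)) : ℝ) ^ (-s) ≤
        (Ideal.absNorm (primeIdeal v : Ideal (𝓞 K)) : ℝ) ^ (-1 : ℝ) := fun v =>
    Real.rpow_le_rpow_of_exponent_le (by linarith [hN v]) (by linarith)
  obtain ⟨h0, h1⟩ := abs_log_norm_tsum_sub_re_le f
    (Summable.of_nonneg_of_le (fun _ => norm_nonneg _) hfle (summable_absNorm_rpow K hs))
    fun v => by
      refine ((hfle _).trans (hNs v)).trans ?_
      rw [Real.rpow_neg_one, one_div]
      exact inv_anti₀ (by norm_num) (hN v)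
  refine ⟨h0, ?_⟩
  have hre : ∀ v, (f (primeIdeal v)).re = (u (primeIdeal v)).re *
      (Ideal.absNorm (primeIdeal v : Ideal (𝓞 K)) : ℝ) ^ (-s) := fun v => Complex.re_mul_ofReal _ _
  simp only [hre] at h1
  have hsq : ∀ v, ‖f (primeIdeal v)‖ ^ 2 ≤
      (Ideal.absNorm (primeIdeal v : Ideal (𝓞 K)) : ℝ) ^ (-2 : ℝ) := fun v => by
    calc ‖f (primeIdeal v)‖ ^ 2 ≤
        ((Ideal.absNorm (primeIdeal v : Ideal (𝓞 K)) : ℝ) ^ (-1 : ℝ)) ^ 2 :=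
          pow_le_pow_left₀ (norm_nonneg _) ((hfle _).trans (hNs v)) 2
      _ = _ := by
        rw [← Real.rpow_natCast, ← Real.rpow_mul (by positivity)]
        norm_num
  have hs2 := summable_absNorm_primeIdeal_rpow K (s := 2) (by norm_num)
  exact h1.trans (Summable.tsum_le_tsum hsq
    (Summable.of_nonneg_of_le (fun _ => sq_nonneg _) hsq hs2) hs2)

lemma norm_classChar_le_one (χ : ClassGroup (𝓞 K) →* ℂ) (c : ClassGroup (𝓞 K)) : ‖χ c‖ ≤ 1 := by
  refine (Complex.norm_eq_one_of_pow_eq_one (n := Fintype.card (ClassGroup (𝓞 K))) ?_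
    Fintype.card_ne_zero).le
  rw [← map_pow, pow_card_eq_one, map_one]

/-- The character `𝔞 ↦ χ([𝔞]) θ(N𝔞)` of the monoid of nonzero ideals. -/
def twistedClassChar {n : ℕ} (χ : ClassGroup (𝓞 K) →* ℂ) (θ : DirichletCharacter ℂ n) :
    (Ideal (𝓞 K))⁰ →* ℂ where
  toFun a := χ (ClassGroup.mk0 a) * θ (Ideal.absNorm (a : Ideal (𝓞 K)) : ℕ)
  map_one' := by simp
  map_mul' a b := by simp; ring

lemma norm_twistedClassChar_le_one {n : ℕ} (χ : ClassGroup (𝓞 K) →* ℂ) (θ : DirichletCharacter ℂ n)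
    (a : (Ideal (𝓞 K))⁰) : ‖twistedClassChar χ θ a‖ ≤ 1 := by
  change ‖χ _ * θ _‖ ≤ 1
  rw [norm_mul]
  exact mul_le_one₀ (norm_classChar_le_one _ _) (norm_nonneg _) (DirichletCharacter.norm_le_one _ _)

lemma exists_norm_tsum_twistedClassChar_le (hK : finrank ℚ K = 2) (σ : K →+* ℝ) {n : ℕ} [NeZero n]
    (χ : ClassGroup (𝓞 K) →* ℂ) {θ : DirichletCharacter ℂ n} (hθ1 : θ (-1) = 1) (hθ : θ ^ 2 ≠ 1) :
    ∃ C : ℝ, ∀ s : ℝ, 1 < s → s ≤ 2 →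
      ‖∑' a : (Ideal (𝓞 K))⁰, twistedClassChar χ θ a *
        ((Ideal.absNorm (a : Ideal (𝓞 K)) : ℝ) ^ (-s) : ℝ)‖ ≤ C := by
  choose C hC using exists_norm_tsum_class_le hK σ θ hθ1 hθ
  refine ⟨∑ c, C c, fun s hs hs' => ?_⟩
  have hsum : Summable fun a : (Ideal (𝓞 K))⁰ => twistedClassChar χ θ a *
      (((Ideal.absNorm (a : Ideal (𝓞 K)) : ℝ) ^ (-s) : ℝ) : ℂ) :=
    Summable.of_norm_bounded (summable_absNorm_rpow K hs) fun a => by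
      rw [norm_mul, Complex.norm_real, Real.norm_of_nonneg (by positivity)]
      exact mul_le_of_le_one_left (by positivity) (norm_twistedClassChar_le_one χ θ a)
  rw [tsum_eq_sum_tsum_fiber (fun a => ClassGroup.mk0 a) hsum]
  refine (norm_sum_le _ _).trans (Finset.sum_le_sum fun c _ => ?_)
  have h : ∀ a : {a : (Ideal (𝓞 K))⁰ // ClassGroup.mk0 a = c}, twistedClassChar χ θ a.1 *
      (((Ideal.absNorm (a.1 : Ideal (𝓞 K)) : ℝ) ^ (-s) : ℝ) : ℂ) =
      χ c * (θ (Ideal.absNorm (a.1 : Ideal (𝓞 K)) : ℕ) *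
          ((Ideal.absNorm (a.1 : Ideal (𝓞 K)) : ℝ) ^ (-s) : ℝ)) := fun a => by
    change χ (ClassGroup.mk0 a.1) * _ * _ = _
    rw [a.2, mul_assoc]
  rw [tsum_congr h, tsum_mul_left, norm_mul]
  exact (mul_le_of_le_one_left (norm_nonneg _) (norm_classChar_le_one χ c)).trans (hC c s hs hs')

lemma exists_tsum_twistedClassChar_re_le (hK : finrank ℚ K = 2) (σ : K →+* ℝ) {n : ℕ} [NeZero n]
    (χ : ClassGroup (𝓞 K) →* ℂ) {θ : DirichletCharacter ℂ n} (hθ1 : θ (-1) = 1) (hθ : θ ^ 2 ≠ 1) :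
    ∃ C : ℝ, ∀ s : ℝ, 1 < s → s ≤ 2 →
      ∑' v, (twistedClassChar χ θ (primeIdeal v)).re *
        (Ideal.absNorm (primeIdeal v : Ideal (𝓞 K)) : ℝ) ^ (-s) ≤ C := by
  obtain ⟨C₁, h₁⟩ := exists_norm_tsum_twistedClassChar_le hK σ χ hθ1 hθ
  obtain ⟨C₂, h₂⟩ := exists_abs_log_norm_tsum_sub_le _ (norm_twistedClassChar_le_one χ θ)
  refine ⟨C₁ + C₂, fun s hs hs' => ?_⟩
  obtain ⟨h0, h3⟩ := h₂ s hs
  have h4 := Real.log_le_sub_one_of_pos (norm_pos_iff.mpr h0)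
  linarith [(abs_le.mp h3).1, h₁ s hs hs']

lemma eventually_tsum_twistedClassChar_one_re_le {n : ℕ} [NeZero n] {χ : ClassGroup (𝓞 K) →* ℂ}
    (hχ : χ ≠ 1) (A : ℝ) : ∀ᶠ s : ℝ in 𝓝[>] 1,
      ∑' v, (twistedClassChar χ (1 : DirichletCharacter ℂ n) (primeIdeal v)).re *
        (Ideal.absNorm (primeIdeal v : Ideal (𝓞 K)) : ℝ) ^ (-s) ≤ -Real.log (s - 1) - A := by
  obtain ⟨C, hC⟩ := exists_abs_log_norm_tsum_sub_le (χ.comp ClassGroup.mk0)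
    fun a => norm_classChar_le_one χ _
  let S : Set (HeightOneSpectrum (𝓞 K)) := {v | v.asIdeal ∣ Ideal.span {(n : 𝓞 K)}}
  have hS : S.Finite := Ideal.finite_factors
    (by simpa [Ideal.span_singleton_eq_bot] using NeZero.ne n)
  have hnotS : ∀ v, v ∉ S → twistedClassChar χ (1 : DirichletCharacter ℂ n) (primeIdeal v) =
      χ.comp ClassGroup.mk0 (primeIdeal v) := by
    intro v hv
    have hn : (n : 𝓞 K) ∉ v.asIdeal := fun h =>
      hv (Ideal.dvd_iff_le.mpr ((Ideal.span_singleton_le_iff_mem _).mpr h))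
    change _ * (1 : DirichletCharacter ℂ n) _ = _
    rw [MulChar.one_apply ((ZMod.isUnit_iff_coprime _ _).mpr (coprime_absNorm_primeIdeal hn)),
      mul_one]
    rfl
  let I : HeightOneSpectrum (𝓞 K) → ℝ := S.indicator fun _ => 2
  obtain ⟨D, hD⟩ : ∃ D, HasSum I D := ⟨_, hasSum_sum_of_ne_finset_zero (s := hS.toFinset)
    fun v hv => Set.indicator_of_notMem (by simpa using hv) _⟩
  have hev := (tendsto_sub_one_mul_tsum_classChar K χ hχ).norm.eventually_lt_const
    (u := Real.exp (-(A + C + D))) (by rw [norm_zero]; exact Real.exp_pos _)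
  filter_upwards [hev, self_mem_nhdsWithin] with s hs hs1
  have hs1' : (1 : ℝ) < s := hs1
  obtain ⟨h0, h1⟩ := hC s hs1'
  have hpos : 0 < s - 1 := sub_pos.mpr hs1'
  have h2 : Real.log (s - 1) + Real.log ‖∑' a : (Ideal (𝓞 K))⁰, χ.comp ClassGroup.mk0 a *
      (((Ideal.absNorm (a : Ideal (𝓞 K)) : ℝ) ^ (-s) : ℝ) : ℂ)‖ < -(A + C + D) := by
    rw [← Real.log_mul hpos.ne' (norm_ne_zero_iff.mpr h0), Real.log_lt_iff_lt_exp
      (mul_pos hpos (norm_pos_iff.mpr h0))]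
    rwa [norm_mul, Complex.norm_real, Real.norm_of_nonneg hpos.le] at hs
  have hsum := summable_absNorm_primeIdeal_rpow K hs1'
  have hle1 : ∀ v : HeightOneSpectrum (𝓞 K),
      (Ideal.absNorm (primeIdeal v : Ideal (𝓞 K)) : ℝ) ^ (-s) ≤ 1 := fun v =>
    Real.rpow_le_one_of_one_le_of_nonpos
      (by exact_mod_cast one_le_two.trans (two_le_absNorm_primeIdeal v)) (by linarith)
  have habs : ∀ z : ℂ, ‖z‖ ≤ 1 → |z.re| ≤ 1 := fun z h => (Complex.abs_re_le_norm z).trans h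
  have hsumre : ∀ u : (Ideal (𝓞 K))⁰ →* ℂ, (∀ a, ‖u a‖ ≤ 1) → Summable fun v =>
      (u (primeIdeal v)).re * (Ideal.absNorm (primeIdeal v : Ideal (𝓞 K)) : ℝ) ^ (-s) :=
    fun u hu => Summable.of_norm_bounded hsum fun v => by
      rw [norm_mul, Real.norm_of_nonneg (r := _ ^ _) (by positivity)]
      exact mul_le_of_le_one_left (by positivity) (habs _ (hu _))
  have h3 : ∑' v, (twistedClassChar χ (1 : DirichletCharacter ℂ n) (primeIdeal v)).re *
        (Ideal.absNorm (primeIdeal v : Ideal (𝓞 K)) : ℝ) ^ (-s) ≤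
      ∑' v, ((χ.comp ClassGroup.mk0 (primeIdeal v)).re *
        (Ideal.absNorm (primeIdeal v : Ideal (𝓞 K)) : ℝ) ^ (-s) + I v) := by
    refine Summable.tsum_le_tsum (fun v => ?_) (hsumre _ (norm_twistedClassChar_le_one χ _))
      ((hsumre _ fun _ => norm_classChar_le_one χ _).add hD.summable)
    by_cases hv : v ∈ S
    · have ha := abs_le.mp (habs _ (norm_twistedClassChar_le_one χ (1 : DirichletCharacter ℂ n)
        (primeIdeal v)))
      have hb := abs_le.mp (habs _ (norm_classChar_le_one χ (ClassGroup.mk0 (primeIdeal v))))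
      have hI : I v = 2 := Set.indicator_of_mem hv _
      have hc : 0 ≤ (Ideal.absNorm (primeIdeal v : Ideal (𝓞 K)) : ℝ) ^ (-s) := by positivity
      have hb1 : -1 ≤ (χ.comp ClassGroup.mk0 (primeIdeal v)).re := hb.1
      rw [hI]
      nlinarith [hle1 v, ha.2, mul_nonneg hc (sub_nonneg.mpr ha.2),
        mul_nonneg hc (by linarith : 0 ≤ (χ.comp ClassGroup.mk0 (primeIdeal v)).re + 1)]
    · have hI : I v = 0 := Set.indicator_of_notMem hv _
      rw [hnotS v hv, hI, add_zero]
  rw [(hsumre _ fun _ => norm_classChar_le_one χ _).tsum_add hD.summable, hD.tsum_eq] at h3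
  linarith [(abs_le.mp h1).1]

end PrimeSums

section PrimeSums

variable {K : Type*} [Field K] [NumberField K]

open Classical in
lemma two_mul_tsum_prime_le {Q : ℕ → Prop} (hQ : ∀ p : Nat.Primes, Q p →
      ∃ v w : HeightOneSpectrum (𝓞 K), v ≠ w ∧
        Ideal.absNorm v.asIdeal = p ∧ Ideal.absNorm w.asIdeal = p) {s : ℝ} (hs : 1 < s) :
    2 * ∑' p : Nat.Primes, (if Q p then (p : ℝ) ^ (-s) else 0) ≤
      ∑' v : HeightOneSpectrum (𝓞 K), if Q (Ideal.absNorm (primeIdeal v : Ideal (𝓞 K)))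
        then (Ideal.absNorm (primeIdeal v : Ideal (𝓞 K)) : ℝ) ^ (-s) else 0 := by
  let P := {p : Nat.Primes | Q p}
  choose v w hvw hv hw using fun p : P => hQ p.1 p.2
  let ι : P × Bool → HeightOneSpectrum (𝓞 K) := fun x => if x.2 then v x.1 else w x.1
  have hι : ∀ x, Ideal.absNorm (primeIdeal (ι x) : Ideal (𝓞 K)) = x.1.1 := by
    rintro ⟨p, _ | _⟩
    · exact hw p
    · exact hv p
  have hinj : Function.Injective ι := by
    rintro ⟨p, b⟩ ⟨p', b'⟩ h
    have hp : p = p' := Subtype.ext (Subtype.ext (by rw [← hι (p, b), ← hι (p', b'), h]))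
    subst hp
    cases b <;> cases b'
    · rfl
    · exact absurd h.symm (hvw p)
    · exact absurd h (hvw p)
    · rfl
  have hsum := (summable_absNorm_primeIdeal_rpow K hs).indicator
    {v | Q (Ideal.absNorm (primeIdeal v : Ideal (𝓞 K)))}
  have hP : Summable fun p : P => ((p.1 : ℕ) : ℝ) ^ (-s) :=
    ((Nat.Primes.summable_rpow.mpr (by linarith)).comp_injective Subtype.val_injective)
  have hι' : ∀ x, ({v | Q (Ideal.absNorm (primeIdeal v : Ideal (𝓞 K)))}.indicator fun v =>
      (Ideal.absNorm (primeIdeal v : Ideal (𝓞 K)) : ℝ) ^ (-s)) (ι x) =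
        ((x.1.1 : ℕ) : ℝ) ^ (-s) := fun x => by
    rw [Set.indicator_of_mem, hι]
    change Q _
    rw [hι]
    exact x.1.2
  have h1 : HasSum (fun x : P × Bool => ((x.1.1 : ℕ) : ℝ) ^ (-s))
      (∑' p : P, ((p.1 : ℕ) : ℝ) ^ (-s) * 2) := by
    have hsm : Summable (fun x : P × Bool => ((x.1.1 : ℕ) : ℝ) ^ (-s)) := by
      exact (summable_congr hι').mp (hsum.comp_injective hinj)
    convert hsm.hasSum using 1
    rw [hsm.tsum_prod]
    refine tsum_congr fun p => ?_
    rw [tsum_bool, mul_two]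
  rw [tsum_mul_right] at h1
  have h2 : ∑' p : Nat.Primes, (if Q p then (p : ℝ) ^ (-s) else 0) =
      ∑' p : P, ((p.1 : ℕ) : ℝ) ^ (-s) :=
    (tsum_subtype P fun p : Nat.Primes => (p : ℝ) ^ (-s)).symm
  rw [h2, mul_comm, ← h1.tsum_eq, ← tsum_congr hι']
  exact tsum_comp_le_tsum_of_inj hsum
    (fun v => Set.indicator_nonneg (fun _ _ => by positivity) v) hinj

open Classical in
lemma tsum_absNorm_rpow_le_of_imp {R R' : ℕ → Prop} (h : ∀ p, R p → R' p) {s : ℝ} (hs : 1 < s) :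
    (∑' v : HeightOneSpectrum (𝓞 K), if R (Ideal.absNorm (primeIdeal v : Ideal (𝓞 K)))
        then (Ideal.absNorm (primeIdeal v : Ideal (𝓞 K)) : ℝ) ^ (-s) else 0) ≤
      ∑' v : HeightOneSpectrum (𝓞 K), if R' (Ideal.absNorm (primeIdeal v : Ideal (𝓞 K)))
        then (Ideal.absNorm (primeIdeal v : Ideal (𝓞 K)) : ℝ) ^ (-s) else 0 := by
  have hsum : ∀ R : HeightOneSpectrum (𝓞 K) → Prop, Summable fun v =>
      if R v then (Ideal.absNorm (primeIdeal v : Ideal (𝓞 K)) : ℝ) ^ (-s) else 0 := fun R =>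
    (summable_absNorm_primeIdeal_rpow K hs).indicator {v | R v}
  refine Summable.tsum_le_tsum (fun v => ?_) (hsum _) (hsum _)
  split_ifs with h1 h2 h2
  · rfl
  · exact absurd (h _ h1) h2
  · positivity
  · rfl

lemma card_dirichletCharacter_pow_eq_one (n : ℕ) [NeZero n] (M : ℕ) :
    Nat.card {ψ : DirichletCharacter ℂ n // ψ ^ M = 1} =
      Nat.card {a : (ZMod n)ˣ // a ^ M = 1} := by
  obtain ⟨e⟩ := DirichletCharacter.mulEquiv_units ℂ n
  exact Nat.card_congr (e.toEquiv.subtypeEquiv fun ψ => by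
    change _ ↔ e ψ ^ M = 1
    rw [← map_pow, EmbeddingLike.map_eq_one_iff])

open Classical in
lemma sum_tsum_twistedClassChar_re {n : ℕ} [NeZero n] {M : ℕ} (hM : M ≠ 0)
    {χ : ClassGroup (𝓞 K) →* ℂ} (hχ : ∀ v : HeightOneSpectrum (𝓞 K),
      ((Ideal.absNorm (primeIdeal v : Ideal (𝓞 K)) : ℕ) : ZMod n) ^ M = 1 →
        χ (ClassGroup.mk0 (primeIdeal v)) = 1) {s : ℝ} (hs : 1 < s) :
    ∑ ψ : DirichletCharacter ℂ n, ∑' v, (twistedClassChar χ (ψ ^ M) (primeIdeal v)).re *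
        (Ideal.absNorm (primeIdeal v : Ideal (𝓞 K)) : ℝ) ^ (-s) =
      n.totient * ∑' v : HeightOneSpectrum (𝓞 K),
        if ((Ideal.absNorm (primeIdeal v : Ideal (𝓞 K)) : ℕ) : ZMod n) ^ M = 1
        then (Ideal.absNorm (primeIdeal v : Ideal (𝓞 K)) : ℝ) ^ (-s) else 0 := by
  have hsum : ∀ u : (Ideal (𝓞 K))⁰ →* ℂ, (∀ a, ‖u a‖ ≤ 1) → Summable fun v =>
      (u (primeIdeal v)).re * (Ideal.absNorm (primeIdeal v : Ideal (𝓞 K)) : ℝ) ^ (-s) :=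
    fun u hu => Summable.of_norm_bounded (summable_absNorm_primeIdeal_rpow K hs) fun v => by
      rw [norm_mul, Real.norm_of_nonneg (r := _ ^ _) (by positivity)]
      exact mul_le_of_le_one_left (by positivity) ((Complex.abs_re_le_norm _).trans (hu _))
  rw [← Summable.tsum_finsetSum fun ψ _ => hsum _ (norm_twistedClassChar_le_one χ (ψ ^ M)),
    ← tsum_mul_left]
  refine tsum_congr fun v => ?_
  rw [← Finset.sum_mul, ← Complex.re_sum]
  have h : ∀ ψ : DirichletCharacter ℂ n, twistedClassChar χ (ψ ^ M) (primeIdeal v) =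
      χ (ClassGroup.mk0 (primeIdeal v)) *
        ψ (((Ideal.absNorm (primeIdeal v : Ideal (𝓞 K)) : ℕ) : ZMod n) ^ M) := fun ψ => by
    change _ * (ψ ^ M) _ = _
    rw [MulChar.pow_apply' _ hM, map_pow]
  rw [Finset.sum_congr rfl fun ψ _ => h ψ, ← Finset.mul_sum, DirichletCharacter.sum_characters_eq]
  split_ifs with h1
  · rw [hχ v h1, one_mul, Complex.natCast_re]
  · simp

theorem classChar_eq_one_of_forall_primeIdeal (hK : finrank ℚ K = 2) (σ : K →+* ℝ)
    {n : ℕ} [NeZero n] {M D : ℕ} (hMD : n.totient = M * D) (hD : Odd D)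
    {χ : ClassGroup (𝓞 K) →* ℂ} (hχ : ∀ v : HeightOneSpectrum (𝓞 K),
      ((Ideal.absNorm (primeIdeal v : Ideal (𝓞 K)) : ℕ) : ZMod n) ^ M = 1 →
        χ (ClassGroup.mk0 (primeIdeal v)) = 1)
    (T : Subgroup (ZMod n)ˣ) (hTM : ∀ a ∈ T, a ^ M = 1)
    (hT : Nat.card {a : (ZMod n)ˣ // a ^ M = 1} ≤ 2 * Nat.card T)
    (hsplit : ∀ p : Nat.Primes, (∃ a ∈ T, (a : ZMod n) = (p : ℕ)) →
      ∃ v w : HeightOneSpectrum (𝓞 K), v ≠ w ∧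
        Ideal.absNorm v.asIdeal = p ∧ Ideal.absNorm w.asIdeal = p) : χ = 1 := by
  classical
  by_contra hne
  have hM : M ≠ 0 := by
    rintro rfl
    rw [zero_mul, Nat.totient_eq_zero] at hMD
    exact NeZero.ne n hMD
  have hψD : ∀ ψ : DirichletCharacter ℂ n, (ψ ^ M) ^ D = 1 := fun ψ => by
    rw [← pow_mul, ← hMD, ← DirichletCharacter.card_eq_totient_of_hasEnoughRootsOfUnity ℂ n]
    exact pow_card_eq_one'
  have hψ1 : ∀ ψ : DirichletCharacter ℂ n, (ψ ^ M) (-1) = 1 := fun ψ => by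
    rcases (ψ ^ M).even_or_odd with h | h
    · exact h
    · have h2 : ((ψ ^ M) ^ D) (-1) = 1 := by
        rw [hψD, MulChar.one_apply isUnit_one.neg]
      rw [MulChar.pow_apply' _ hD.pos.ne', h, hD.neg_one_pow] at h2
      exact absurd h2 (by norm_num)
  have hψ2 : ∀ ψ : DirichletCharacter ℂ n, ψ ^ M ≠ 1 → (ψ ^ M) ^ 2 ≠ 1 := fun ψ h1 h2 => by
    obtain ⟨k, rfl⟩ := hD
    have := hψD ψ
    rw [pow_succ, pow_mul, h2, one_pow, one_mul] at this
    exact h1 this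
  have hup : ∀ ψ : DirichletCharacter ℂ n, ∃ C : ℝ, ψ ^ M ≠ 1 → ∀ s : ℝ, 1 < s → s ≤ 2 →
      ∑' v, (twistedClassChar χ (ψ ^ M) (primeIdeal v)).re *
        (Ideal.absNorm (primeIdeal v : Ideal (𝓞 K)) : ℝ) ^ (-s) ≤ C := fun ψ => by
    by_cases h : ψ ^ M = 1
    · exact ⟨0, fun h' => absurd h h'⟩
    · obtain ⟨C, hC⟩ := exists_tsum_twistedClassChar_re_le hK σ χ (hψ1 ψ) (hψ2 ψ h)
      exact ⟨C, fun _ => hC⟩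
  choose C hC using hup
  obtain ⟨C', hC'⟩ := exists_eventually_le_tsum_prime_mem T
  let A := ∑ ψ, |C ψ| + 2 * |C'| + 1
  obtain ⟨s, ⟨hs1, hs2, hs3⟩⟩ := (hC'.and ((eventually_tsum_twistedClassChar_one_re_le (n := n) hne
    A).and (Ioo_mem_nhdsGT (one_lt_two (α := ℝ))))).exists
  set Z := -Real.log (s - 1)
  have hZ : 0 ≤ Z := neg_nonneg.mpr (Real.log_nonpos (by linarith [hs3.1]) (by linarith [hs3.2]))
  have hbound : ∀ ψ : DirichletCharacter ℂ n,
      ∑' v, (twistedClassChar χ (ψ ^ M) (primeIdeal v)).re *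
        (Ideal.absNorm (primeIdeal v : Ideal (𝓞 K)) : ℝ) ^ (-s) ≤
      |C ψ| + if ψ ^ M = 1 then Z - A else 0 := fun ψ => by
    split_ifs with h
    · rw [h]
      linarith [abs_nonneg (C ψ)]
    · linarith [hC ψ h s hs3.1 hs3.2.le, le_abs_self (C ψ)]
  have hS := Finset.sum_le_sum fun ψ (_ : ψ ∈ Finset.univ) => hbound ψ
  rw [sum_tsum_twistedClassChar_re hM hχ hs3.1, Finset.sum_add_distrib, ← Finset.sum_filter,
    Finset.sum_const, nsmul_eq_mul, ← Fintype.card_subtype, ← Nat.card_eq_fintype_card,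
    card_dirichletCharacter_pow_eq_one] at hS
  have hpos : 1 ≤ Nat.card {a : (ZMod n)ˣ // a ^ M = 1} :=
    have : Nonempty {a : (ZMod n)ˣ // a ^ M = 1} := ⟨1, one_pow M⟩
    Nat.card_pos
  have hlow := two_mul_tsum_prime_le (K := K) (Q := fun p => ∃ a ∈ T, (a : ZMod n) = (p : ℕ))
    hsplit hs3.1
  have hmono := tsum_absNorm_rpow_le_of_imp (K := K) (R := fun p => ∃ a ∈ T, (a : ZMod n) = (p : ℕ))
    (R' := fun p => (p : ZMod n) ^ M = 1) (fun p hp => by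
      obtain ⟨a, ha, hav⟩ := hp
      rw [← hav, ← Units.val_pow_eq_pow_val, hTM a ha, Units.val_one]) hs3.1
  have hT' : (Nat.card {a : (ZMod n)ˣ // a ^ M = 1} : ℝ) ≤ 2 * Nat.card T := by exact_mod_cast hT
  have hpos' : (1 : ℝ) ≤ Nat.card {a : (ZMod n)ˣ // a ^ M = 1} := by exact_mod_cast hpos
  have hA : 0 ≤ A := by positivity
  have h1 := mul_le_mul_of_nonneg_left (hlow.trans hmono) (Nat.cast_nonneg (α := ℝ) n.totient)
  have h2 := mul_le_mul_of_nonneg_right hT' hZ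
  have h3 := mul_le_mul_of_nonneg_right hpos' hA
  have h4 := le_abs_self C'
  have h5 : ∑ ψ, |C ψ| + 2 * |C'| + 1 ≤ A := le_rfl
  rw [mul_sub] at hS
  clear_value A Z
  generalize ∑ ψ, |C ψ| = W at *
  generalize (Nat.card {a : (ZMod n)ˣ // a ^ M = 1} : ℝ) = c at *
  obtain ⟨X, h6, h7⟩ : ∃ X : ℝ, Nat.card T * Z - C' ≤ n.totient * X ∧
      n.totient * (2 * X) ≤ W + (c * Z - c * A) :=
    ⟨_, hs1, le_trans (by convert h1) hS⟩
  linarith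

end PrimeSums

section SplitPrimes

variable (n : ℕ) [NeZero n] (K L : Type*) [Field K] [NumberField K] [Field L] [NumberField L]
  [Algebra K L] [IsCyclotomicExtension {n} ℚ L]

open Pointwise in
theorem inertiaDegIn_eq_one_of_mem_range (hK : IsGalois ℚ K) {p : ℕ} [hp : Fact p.Prime]
    (hn : p.Coprime n) (hpK : ZMod.unitOfCoprime p hn ∈
      ((IsCyclotomicExtension.Rat.galEquivZMod n L).toMonoidHom.comp
        (AlgEquiv.restrictScalarsHom ℚ : Gal(L/K) →* Gal(L/ℚ))).range) :
    (Ideal.span {(p : ℤ)}).ramificationIdxIn (𝓞 K) = 1 ∧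
      (Ideal.span {(p : ℤ)}).inertiaDegIn (𝓞 K) = 1 := by
  have hL : IsGalois ℚ L := IsCyclotomicExtension.isGalois {n} ℚ L
  have hLK : IsGalois K L := IsGalois.tower_top_of_isGalois ℚ K L
  have hnd : ¬ p ∣ n := (Nat.Prime.coprime_iff_not_dvd hp.out).mp hn
  have hmax : (Ideal.span {(p : ℤ)}).IsMaximal := Int.ideal_span_isMaximal_of_prime p
  obtain ⟨⟨Q, hQp, hQo⟩⟩ := (Ideal.span {(p : ℤ)}).nonempty_primesOver (S := 𝓞 L)
  have hQm : Q.IsMaximal := .of_liesOver_isMaximal Q (Ideal.span {(p : ℤ)})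
  set P : Ideal (𝓞 K) := Q.under (𝓞 K)
  have hQP : Q.LiesOver P := ⟨rfl⟩
  have hPo : P.LiesOver (Ideal.span {(p : ℤ)}) := Ideal.LiesOver.tower_bot Q P _
  have hPm : P.IsMaximal := .of_liesOver_isMaximal P (Ideal.span {(p : ℤ)})
  have hne : Nonempty (P.primesOver (𝓞 L)) := ⟨⟨Q, hQp, hQP⟩⟩
  have he := Ideal.ramificationIdxIn_mul_ramificationIdxIn (p := Ideal.span {(p : ℤ)}) P
    Gal(K/ℚ) (𝓞 L) Gal(L/ℚ) Gal(L/K)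
  rw [IsCyclotomicExtension.Rat.ramificationIdxIn_eq_of_not_dvd p L hnd] at he
  have he1 := Nat.eq_one_of_mul_eq_one_right he
  have he2 := Nat.eq_one_of_mul_eq_one_left he
  have hf := Ideal.inertiaDegIn_mul_inertiaDegIn (Ideal.span {(p : ℤ)}) P
    Gal(K/ℚ) (𝓞 L) Gal(L/ℚ) Gal(L/K)
  have hs1 := Ideal.card_stabilizer_eq (G := Gal(L/ℚ)) (Ideal.span {(p : ℤ)}) Q
  have hs2 := Ideal.card_stabilizer_eq (G := Gal(L/K)) P Q
  have hle : Nat.card (MulAction.stabilizer Gal(L/ℚ) Q) ≤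
      Nat.card (MulAction.stabilizer Gal(L/K) Q) := by
    have hex : ∀ σ : MulAction.stabilizer Gal(L/ℚ) Q,
        ∃ τ : Gal(L/K), AlgEquiv.restrictScalarsHom ℚ τ = (σ : Gal(L/ℚ)) := by
      intro σ
      obtain ⟨k, hk⟩ := Subgroup.mem_zpowers_iff.mp
        (IsCyclotomicExtension.Rat.mem_zpowers_galEquivZMod_of_mem_stabilizer n L p Q hn σ.2)
      obtain ⟨τ, hτ⟩ := Subgroup.zpow_mem _ hpK k
      exact ⟨τ, (IsCyclotomicExtension.Rat.galEquivZMod n L).injective (hτ.trans hk)⟩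
    choose g hg using hex
    have hgs : ∀ σ, g σ ∈ MulAction.stabilizer Gal(L/K) Q := by
      intro σ
      have h1 := σ.2
      rw [← hg σ] at h1
      exact h1
    refine Nat.card_le_card_of_injective
      (fun σ ↦ (⟨g σ, hgs σ⟩ : MulAction.stabilizer Gal(L/K) Q)) ?_
    intro σ τ h
    apply Subtype.ext
    rw [← hg σ, ← hg τ, Subtype.mk.inj h]
  rw [hs1, hs2, he2, one_mul, IsCyclotomicExtension.Rat.ramificationIdxIn_eq_of_not_dvd p L hnd,
    one_mul, ← hf] at hle
  have hpos : 0 < P.inertiaDegIn (𝓞 L) :=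
    Nat.pos_of_ne_zero (Ideal.inertiaDegIn_ne_zero (A := 𝓞 K) Gal(L/K))
  have hpos' : (Ideal.span {(p : ℤ)}).inertiaDegIn (𝓞 K) ≠ 0 :=
    Ideal.inertiaDegIn_ne_zero (A := ℤ) Gal(K/ℚ)
  refine ⟨he1, ?_⟩
  nlinarith [Nat.pos_of_ne_zero hpos']

theorem exists_split_of_mem_range (hK2 : finrank ℚ K = 2) {p : ℕ} [hp : Fact p.Prime]
    (hn : p.Coprime n) (hpK : ZMod.unitOfCoprime p hn ∈
      ((IsCyclotomicExtension.Rat.galEquivZMod n L).toMonoidHom.comp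
        (AlgEquiv.restrictScalarsHom ℚ : Gal(L/K) →* Gal(L/ℚ))).range) :
    ∃ v w : HeightOneSpectrum (𝓞 K), v ≠ w ∧ Ideal.absNorm v.asIdeal = p ∧
      Ideal.absNorm w.asIdeal = p := by
  have : Algebra.IsQuadraticExtension ℚ K := ⟨hK2⟩
  have hK : IsGalois ℚ K := inferInstance
  have hmax : (Ideal.span {(p : ℤ)}).IsMaximal := Int.ideal_span_isMaximal_of_prime p
  obtain ⟨he, hf⟩ := inertiaDegIn_eq_one_of_mem_range n K L hK hn hpK
  have h := Ideal.ncard_primesOver_mul_ramificationIdxIn_mul_inertiaDegIn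
    (Ideal.span {(p : ℤ)}) (𝓞 K) Gal(K/ℚ)
  rw [he, hf, mul_one, mul_one, IsGalois.card_aut_eq_finrank, hK2] at h
  obtain ⟨P, Q, hPQ, hS⟩ := Set.ncard_eq_two.mp h
  have key : ∀ R ∈ (Ideal.span {(p : ℤ)}).primesOver (𝓞 K),
      R.IsPrime ∧ R ≠ ⊥ ∧ Ideal.absNorm R = p := by
    rintro R ⟨hR1, hR2⟩
    refine ⟨hR1, ?_, ?_⟩
    · exact Ideal.ne_bot_of_liesOver_of_ne_bot (p := Ideal.span {(p : ℤ)})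
        (by simpa using hp.out.ne_zero) R
    · rw [← Ideal.pow_inertiaDeg p, ← Ideal.inertiaDegIn_eq_inertiaDeg (Ideal.span {(p : ℤ)}) R
        Gal(K/ℚ), hf, pow_one]
  obtain ⟨hP1, hP2, hP3⟩ := key P (by rw [hS]; simp)
  obtain ⟨hQ1, hQ2, hQ3⟩ := key Q (by rw [hS]; simp)
  exact ⟨⟨P, hP1, hP2⟩, ⟨Q, hQ1, hQ2⟩, fun h ↦ hPQ (congrArg HeightOneSpectrum.asIdeal h), hP3, hQ3⟩

theorem index_range_restrictScalarsHom (hK2 : finrank ℚ K = 2) :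
    ((IsCyclotomicExtension.Rat.galEquivZMod n L).toMonoidHom.comp
        (AlgEquiv.restrictScalarsHom ℚ : Gal(L/K) →* Gal(L/ℚ))).range.index = 2 := by
  have hL : IsGalois ℚ L := IsCyclotomicExtension.isGalois {n} ℚ L
  have hLK : IsGalois K L := IsGalois.tower_top_of_isGalois ℚ K L
  set f := (IsCyclotomicExtension.Rat.galEquivZMod n L).toMonoidHom.comp
        (AlgEquiv.restrictScalarsHom ℚ : Gal(L/K) →* Gal(L/ℚ))
  have hinj : Function.Injective f :=
    (IsCyclotomicExtension.Rat.galEquivZMod n L).injective.comp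
      (AlgEquiv.restrictScalars_injective ℚ)
  have h1 : Nat.card f.range = Nat.card Gal(L/K) :=
    (Nat.card_congr (f.ofInjective hinj).toEquiv).symm
  have h2 := f.range.card_mul_index
  have h3 : Nat.card (ZMod n)ˣ = Nat.card Gal(L/ℚ) :=
    (Nat.card_congr (IsCyclotomicExtension.Rat.galEquivZMod n L).toEquiv).symm
  rw [h1, h3, IsGalois.card_aut_eq_finrank, IsGalois.card_aut_eq_finrank,
    ← finrank_mul_finrank ℚ K L, hK2, mul_comm] at h2
  exact Nat.eq_of_mul_eq_mul_right finrank_pos h2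

theorem card_pow_eq_one_le_two_mul_card_inf {G : Type*} [CommGroup G] [Finite G] (D : Subgroup G)
    (hD : D.index = 2) (M : ℕ) :
    Nat.card {a : G // a ^ M = 1} ≤
      2 * Nat.card (D ⊓ (powMonoidHom M : G →* G).ker : Subgroup G) := by
  have h1 : Nat.card {a : G // a ^ M = 1} = Nat.card (powMonoidHom M : G →* G).ker :=
    Nat.card_congr (Equiv.subtypeEquivRight fun a ↦ by simp [MonoidHom.mem_ker])
  have h2 := Subgroup.relIndex_mul_relIndex ⊥ (D ⊓ (powMonoidHom M : G →* G).ker) _ bot_le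
    inf_le_right
  have h3 : (D ⊓ (powMonoidHom M : G →* G).ker).relIndex (powMonoidHom M : G →* G).ker ≤ 2 := by
    rw [Subgroup.inf_relIndex_right, ← hD]
    exact Nat.le_of_dvd (by rw [hD]; norm_num) (Subgroup.relIndex_dvd_index_of_normal _ _)
  rw [Subgroup.relIndex_bot_left, Subgroup.relIndex_bot_left] at h2
  rw [h1, ← h2, mul_comm]
  gcongr

end SplitPrimes

section ClassGroupNorm

variable (R S : Type*) [CommRing R] [CommRing S] [IsDedekindDomain R] [IsDedekindDomain S]
  [Algebra R S] [Module.Finite R S] [IsTorsionFree R S]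

/-- The relative norm on nonzero ideals. -/
def relNormNonzero : (Ideal S)⁰ →* (Ideal R)⁰ where
  toFun I := ⟨Ideal.relNorm R (I : Ideal S), mem_nonZeroDivisors_of_ne_zero fun h ↦
    mem_nonZeroDivisors_iff_ne_zero.mp I.2 (Ideal.relNorm_eq_bot_iff.mp h)⟩
  map_one' := Subtype.ext (map_one (Ideal.relNorm R))
  map_mul' I J := Subtype.ext (map_mul (Ideal.relNorm R) (I : Ideal S) (J : Ideal S))

theorem mk0_relNormNonzero_eq {I J : (Ideal S)⁰} (h : ClassGroup.mk0 I = ClassGroup.mk0 J) :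
    ClassGroup.mk0 (relNormNonzero R S I) = ClassGroup.mk0 (relNormNonzero R S J) := by
  obtain ⟨x, y, hx, hy, hxy⟩ := ClassGroup.mk0_eq_mk0_iff.mp h
  refine ClassGroup.mk0_eq_mk0_iff.mpr ⟨Algebra.intNorm R S x, Algebra.intNorm R S y,
    Algebra.intNorm_ne_zero.mpr hx, Algebra.intNorm_ne_zero.mpr hy, ?_⟩
  have := congrArg (Ideal.relNorm R) hxy
  rwa [map_mul, map_mul, Ideal.relNorm_singleton, Ideal.relNorm_singleton] at this

/-- The homomorphism of class groups induced by the relative norm of ideals. -/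
def classGroupNorm : ClassGroup S →* ClassGroup R :=
  MonoidHom.mk' (fun c ↦ ClassGroup.mk0 (relNormNonzero R S
    (Function.surjInv ClassGroup.mk0_surjective c))) fun a b ↦ by
    rw [← map_mul, ← map_mul]
    refine mk0_relNormNonzero_eq R S ?_
    rw [map_mul]
    simp only [Function.surjInv_eq]

theorem classGroupNorm_mk0 (I : (Ideal S)⁰) :
    classGroupNorm R S (ClassGroup.mk0 I) = ClassGroup.mk0 (relNormNonzero R S I) :=
  mk0_relNormNonzero_eq R S (Function.surjInv_eq _ _)

end ClassGroupNorm

section NormTrivial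

theorem classChar_primeIdeal_eq_one (n : ℕ) [NeZero n] (K H L : Type*) [Field K] [NumberField K]
    [Field H] [NumberField H] [Field L] [NumberField L] [Algebra K H] [Algebra H L] [Algebra K L]
    [IsScalarTower K H L] [IsCyclotomicExtension {n} ℚ L] (hK : finrank ℚ K = 2) {ℓ M : ℕ}
    (hℓ : ℓ.Prime) (hℓ2 : ℓ ≠ 2)
    (hM : ¬ ℓ ∣ M) {χ : ClassGroup (𝓞 K) →* ℂ} (hχℓ : ∀ c, χ c ^ ℓ = 1)
    (hχN : ∀ c, χ (classGroupNorm (𝓞 K) (𝓞 H) c) = 1) (v : HeightOneSpectrum (𝓞 K))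
    (hv : ((Ideal.absNorm (primeIdeal v : Ideal (𝓞 K)) : ℕ) : ZMod n) ^ M = 1) :
    χ (ClassGroup.mk0 (primeIdeal v)) = 1 := by
  have hM0 : M ≠ 0 := fun h ↦ hM (h ▸ dvd_zero ℓ)
  have hvm : v.asIdeal.IsMaximal := v.isMaximal
  obtain ⟨p, hp, hpo⟩ : ∃ p : ℕ, p.Prime ∧ v.asIdeal.LiesOver (Ideal.span {(p : ℤ)}) :=
    ⟨_, Nat.absNorm_under_prime v.asIdeal, Int.liesOver_span_absNorm v.asIdeal⟩
  have := Fact.mk hp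
  have hmax : (Ideal.span {(p : ℤ)}).IsMaximal := Int.ideal_span_isMaximal_of_prime p
  set f := v.asIdeal.inertiaDeg ℤ
  have hf0 : 0 < f := Ideal.inertiaDeg_pos v.asIdeal ℤ
  have hN : p ^ f = Ideal.absNorm v.asIdeal := Ideal.pow_inertiaDeg p _
  have : Algebra.IsQuadraticExtension ℚ K := ⟨hK⟩
  have hKg : IsGalois ℚ K := inferInstance
  have hf2 : f ∣ 2 := by
    have h := Ideal.ncard_primesOver_mul_ramificationIdxIn_mul_inertiaDegIn
      (Ideal.span {(p : ℤ)}) (𝓞 K) Gal(K/ℚ)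
    rw [Ideal.inertiaDegIn_eq_inertiaDeg (Ideal.span {(p : ℤ)}) v.asIdeal Gal(K/ℚ), ← mul_assoc,
      IsGalois.card_aut_eq_finrank, hK] at h
    exact Dvd.intro_left _ h
  have hpow : (p : ZMod n) ^ (f * M) = 1 := by
    rw [pow_mul]
    change ((Ideal.absNorm v.asIdeal : ℕ) : ZMod n) ^ M = 1 at hv
    rw [← hN] at hv
    exact_mod_cast hv
  have hpn : ¬ p ∣ n := by
    have hu : IsUnit ((p : ℕ) : ZMod n) :=
      IsUnit.of_pow_eq_one hpow (Nat.mul_ne_zero hf0.ne' hM0)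
    exact (Nat.Prime.coprime_iff_not_dvd hp).mp ((ZMod.isUnit_iff_coprime p n).mp hu)
  obtain ⟨⟨Q, hQp, hQo⟩⟩ := v.asIdeal.nonempty_primesOver (S := 𝓞 L)
  have hQp' : Q.LiesOver (Ideal.span {(p : ℤ)}) := Ideal.LiesOver.trans Q v.asIdeal _
  have hQm : Q.IsMaximal := .of_liesOver_isMaximal Q v.asIdeal
  set P : Ideal (𝓞 H) := Q.under (𝓞 H)
  have hQP : Q.LiesOver P := ⟨rfl⟩
  have hPo : P.LiesOver v.asIdeal := Ideal.LiesOver.tower_bot Q P _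
  have hPm : P.IsMaximal := .of_liesOver_isMaximal P v.asIdeal
  have hd : Q.inertiaDeg ℤ = orderOf (p : ZMod n) :=
    IsCyclotomicExtension.Rat.inertiaDeg_eq_of_not_dvd p L Q hpn
  have hdvd : P.inertiaDeg (𝓞 K) ∣ 2 * M := by
    have h1 : P.inertiaDeg (𝓞 K) ∣ Q.inertiaDeg ℤ := by
      rw [Ideal.inertiaDeg_tower (R := ℤ) v.asIdeal Q, Ideal.inertiaDeg_tower (R := 𝓞 K) P Q]
      exact Dvd.dvd.mul_left (dvd_mul_right _ _) _
    refine h1.trans (hd ▸ (orderOf_dvd_of_pow_eq_one hpow).trans (Nat.mul_dvd_mul_right hf2 M))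
  have hco : Nat.Coprime (P.inertiaDeg (𝓞 K)) ℓ := by
    refine Nat.Coprime.coprime_dvd_left hdvd (Nat.Coprime.symm ?_)
    refine (Nat.Prime.coprime_iff_not_dvd hℓ).mpr fun h ↦ ?_
    rcases hℓ.dvd_mul.mp h with h | h
    · exact hℓ2 ((Nat.prime_dvd_prime_iff_eq hℓ Nat.prime_two).mp h)
    · exact hM h
  have hPb : P ≠ ⊥ := Ideal.ne_bot_of_liesOver_of_ne_bot (p := v.asIdeal) v.ne_bot P
  have hrel : relNormNonzero (𝓞 K) (𝓞 H) ⟨P, mem_nonZeroDivisors_of_ne_zero hPb⟩ =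
      primeIdeal v ^ P.inertiaDeg (𝓞 K) :=
    Subtype.ext (Ideal.relNorm_eq_pow_of_isMaximal P v.asIdeal)
  have h1 := hχN (ClassGroup.mk0 ⟨P, mem_nonZeroDivisors_of_ne_zero hPb⟩)
  rw [classGroupNorm_mk0, hrel, map_pow, map_pow] at h1
  have h2 := pow_gcd_eq_one.mpr ⟨h1, hχℓ (ClassGroup.mk0 (primeIdeal v))⟩
  rwa [hco, pow_one] at h2

end NormTrivial

section FiniteAbelian

theorem exists_monoidHom_complex_of_dvd_index {G : Type*} [CommGroup G] [Finite G] (N : Subgroup G)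
    {ℓ : ℕ} (hℓ : ℓ.Prime) (h : ℓ ∣ N.index) :
    ∃ χ : G →* ℂ, χ ≠ 1 ∧ (∀ c, χ c ^ ℓ = 1) ∧ ∀ c ∈ N, χ c = 1 := by
  have := Fact.mk hℓ
  obtain ⟨x, hx⟩ := exists_prime_orderOf_dvd_card' (G := G ⧸ N) ℓ h
  have hninj : ¬ Function.Injective (powMonoidHom ℓ : G ⧸ N →* G ⧸ N) := fun hinj ↦ by
    have h1 : x = 1 := hinj (by
      simp only [powMonoidHom_apply, one_pow]
      rw [← hx, pow_orderOf_eq_one])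
    rw [h1, orderOf_one] at hx
    exact hℓ.one_lt.ne hx
  have hnsurj : ¬ Function.Surjective (powMonoidHom ℓ : G ⧸ N →* G ⧸ N) :=
    fun hs ↦ hninj (Finite.injective_iff_surjective.mpr hs)
  simp only [Function.Surjective, not_forall] at hnsurj
  obtain ⟨b, hb⟩ := hnsurj
  set R := (powMonoidHom ℓ : G ⧸ N →* G ⧸ N).range
  have hb1 : (QuotientGroup.mk' R b) ≠ 1 := fun hb' ↦
    hb ((QuotientGroup.eq_one_iff b).mp hb')
  obtain ⟨φ, hφ⟩ := CommGroup.exists_apply_ne_one_of_hasEnoughRootsOfUnity ((G ⧸ N) ⧸ R) ℂ hb1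
  obtain ⟨g, rfl⟩ := QuotientGroup.mk'_surjective N b
  refine ⟨(Units.coeHom ℂ).comp (φ.comp ((QuotientGroup.mk' R).comp (QuotientGroup.mk' N))),
    fun h1 ↦ hφ ?_, fun c ↦ ?_, fun c hc ↦ ?_⟩
  · exact Units.ext (DFunLike.congr_fun h1 g)
  · have h2 : (QuotientGroup.mk' R (QuotientGroup.mk' N c)) ^ ℓ = 1 := by
      rw [← map_pow]
      exact (QuotientGroup.eq_one_iff _).mpr ⟨QuotientGroup.mk' N c, rfl⟩
    change ((φ (QuotientGroup.mk' R (QuotientGroup.mk' N c)) : ℂˣ) : ℂ) ^ ℓ = 1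
    rw [← Units.val_pow_eq_pow_val, ← map_pow, h2, map_one, Units.val_one]
  · have h2 : QuotientGroup.mk' N c = 1 := (QuotientGroup.eq_one_iff _).mpr hc
    simp only [MonoidHom.comp_apply, h2, map_one]

variable {A B : Type*} [CommGroup A] [CommGroup B]

theorem mem_pPart_iff {p : ℕ} (hp : p.Prime) {x : A} :
    x ∈ pPart A p hp ↔ ∃ k, x ^ p ^ k = 1 :=
  Iff.rfl

/-- The homomorphism induced between `p`-parts. -/
def pPartMap (f : A →* B) (p : ℕ) (hp : p.Prime) : pPart A p hp →* pPart B p hp :=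
  (f.comp (pPart A p hp).subtype).codRestrict _ fun x ↦ by
    obtain ⟨k, hk⟩ := (mem_pPart_iff hp).mp x.2
    exact (mem_pPart_iff hp).mpr ⟨k, by simp [← map_pow, hk]⟩

theorem pPartMap_surjective [Finite A] (f : A →* B) {p k : ℕ} (hp : p.Prime)
    (hB : pCard B p hp = p ^ k) (hf : ¬ p ∣ f.range.index) :
    Function.Surjective (pPartMap f p hp) := by
  intro b
  obtain ⟨s, u, hu, hA⟩ := Nat.exists_eq_pow_mul_and_not_dvd (Nat.card_pos (α := A)).ne' p hp.ne_one
  have hco : (Nat.card (pPart B p hp)).Coprime (f.range.index * u) := by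
    rw [show Nat.card (pPart B p hp) = p ^ k from hB]
    refine Nat.Coprime.pow_left k ((Nat.Prime.coprime_iff_not_dvd hp).mpr fun h ↦ ?_)
    exact (hp.dvd_mul.mp h).elim hf hu
  obtain ⟨b₀, rfl⟩ := (powCoprime hco).surjective b
  obtain ⟨a, ha⟩ := f.range.pow_index_mem (b₀ : B)
  refine ⟨⟨a ^ u, (mem_pPart_iff hp).mpr ⟨s, ?_⟩⟩, ?_⟩
  · rw [← pow_mul, mul_comm, ← hA, pow_card_eq_one']
  · apply Subtype.ext
    change f (a ^ u) = ((b₀ ^ (f.range.index * u) : pPart B p hp) : B)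
    rw [map_pow, ha, ← pow_mul, Subgroup.coe_pow]

theorem pRank_le_and_le [Finite A] [Finite B] (f : A →* B) {p m : ℕ} (hp : p.Prime) (hm : 1 ≤ m)
    (hA : pCard A p hp = p ^ m) (hB : pCard B p hp = p ^ (m - 1)) (hf : ¬ p ∣ f.range.index) :
    pRank B p hp ≤ pRank A p hp ∧ pRank A p hp ≤ 1 + pRank B p hp := by
  set g := pPartMap f p hp
  have hgs : Function.Surjective g := pPartMap_surjective f hp hB hf
  set PA := (powMonoidHom p : pPart A p hp →* pPart A p hp).range
  set PB := (powMonoidHom p : pPart B p hp →* pPart B p hp).range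
  have hmap : PA.map g = PB := by
    apply le_antisymm
    · rintro _ ⟨_, ⟨x, rfl⟩, rfl⟩
      exact ⟨g x, (map_pow g x p).symm⟩
    · rintro _ ⟨y, rfl⟩
      obtain ⟨x, rfl⟩ := hgs y
      exact ⟨x ^ p, ⟨x, rfl⟩, map_pow g x p⟩
  have hidx : PB.index = (PA ⊔ g.ker).index := by
    rw [← hmap, Subgroup.index_map, MonoidHom.range_eq_top.mpr hgs, Subgroup.index_top, mul_one]
  have hker : Nat.card g.ker = p := by
    have h1 := g.ker.card_mul_index
    rw [Subgroup.index_ker, MonoidHom.range_eq_top.mpr hgs, Subgroup.card_top] at h1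
    change _ * pCard B p hp = pCard A p hp at h1
    rw [hA, hB] at h1
    obtain ⟨j, rfl⟩ := Nat.exists_eq_add_of_le' hm
    rw [Nat.add_sub_cancel, pow_succ, mul_comm (p ^ j)] at h1
    exact Nat.eq_of_mul_eq_mul_right (pow_pos hp.pos j) h1
  have hrel : PA.relIndex (PA ⊔ g.ker) ∣ p := by
    rw [Subgroup.relIndex_sup_left]
    exact (Subgroup.relIndex_dvd_card _ _).trans hker.dvd
  have hmul : PA.relIndex (PA ⊔ g.ker) * PB.index = PA.index := by
    rw [hidx, Subgroup.relIndex_mul_index le_sup_left]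
  have hA0 : PA.index ≠ 0 := Subgroup.index_ne_zero_of_finite
  have hB0 : PB.index ≠ 0 := Subgroup.index_ne_zero_of_finite
  change PB.index.factorization p ≤ PA.index.factorization p ∧
    PA.index.factorization p ≤ 1 + PB.index.factorization p
  constructor
  · exact (Nat.factorization_le_iff_dvd hB0 hA0).mpr (Dvd.intro_left _ hmul) p
  · have h1 : PA.index ∣ p * PB.index := hmul ▸ Nat.mul_dvd_mul_right hrel _
    have h2 := (Nat.factorization_le_iff_dvd hA0 (Nat.mul_ne_zero hp.ne_zero hB0)).mpr h1 p
    rwa [Nat.factorization_mul hp.ne_zero hB0, Finsupp.add_apply, hp.factorization_self] at h2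

end FiniteAbelian

section Index

theorem not_dvd_index_range_classGroupNorm (n : ℕ) [NeZero n] (K H L : Type*) [Field K]
    [NumberField K] [Field H] [NumberField H] [Field L] [NumberField L] [Algebra K H] [Algebra H L]
    [Algebra K L] [IsScalarTower K H L] [IsCyclotomicExtension {n} ℚ L] (hK : finrank ℚ K = 2)
    (σ : K →+* ℝ) {ℓ : ℕ} (hℓ : ℓ.Prime) (hℓ2 : Odd ℓ) :
    ¬ ℓ ∣ (classGroupNorm (𝓞 K) (𝓞 H)).range.index := by
  intro h
  obtain ⟨χ, hχ1, hχℓ, hχN⟩ := exists_monoidHom_complex_of_dvd_index _ hℓ h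
  obtain ⟨k, M, hM, hn⟩ := Nat.exists_eq_pow_mul_and_not_dvd
    (Nat.totient_pos.mpr (NeZero.pos n)).ne' ℓ hℓ.ne_one
  refine hχ1 (classChar_eq_one_of_forall_primeIdeal hK σ (hn.trans (mul_comm _ _)) (hℓ2.pow)
    (classChar_primeIdeal_eq_one n K H L hK hℓ (fun h2 ↦ by subst h2; exact absurd hℓ2 (by decide))
      hM hχℓ fun c ↦ hχN _ ⟨c, rfl⟩)
    (((IsCyclotomicExtension.Rat.galEquivZMod n L).toMonoidHom.comp
        (AlgEquiv.restrictScalarsHom ℚ : Gal(L/K) →* Gal(L/ℚ))).range ⊓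
      (powMonoidHom M : (ZMod n)ˣ →* (ZMod n)ˣ).ker)
    (fun a ha ↦ ha.2)
    (card_pow_eq_one_le_two_mul_card_inf _ (index_range_restrictScalarsHom n K L hK) M) ?_)
  rintro p ⟨a, ha, hap⟩
  have hp := Fact.mk p.2
  have hn : (p : ℕ).Coprime n := (ZMod.isUnit_iff_coprime _ n).mp (hap ▸ a.isUnit)
  refine exists_split_of_mem_range n K L hK hn ?_
  rw [show ZMod.unitOfCoprime (p : ℕ) hn = a from
    Units.ext ((ZMod.coe_unitOfCoprime _ hn).trans hap.symm)]
  exact ha.1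

end Index

section RealCyclo

theorem isPrimitiveRoot_zetaC {n : ℕ} (hn : n ≠ 0) : IsPrimitiveRoot (zetaC n) n :=
  Complex.isPrimitiveRoot_exp n hn

theorem realCyclo_le_adjoin_zetaC (n : ℕ) : realCyclo n ≤ ℚ⟮zetaC n⟯ := by
  have h : zetaC n ∈ ℚ⟮zetaC n⟯ := mem_adjoin_simple_self ℚ _
  exact adjoin_simple_le_iff.mpr (add_mem h (inv_mem h))

theorem realCyclo_le_fieldRange (n : ℕ) (hn : n ≠ 0) :
    realCyclo n ≤ (IsScalarTower.toAlgHom ℚ ℝ ℂ).fieldRange := by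
  refine adjoin_simple_le_iff.mpr ⟨2 * (zetaC n).re, ?_⟩
  have h : ‖zetaC n‖ = 1 := Complex.norm_eq_one_of_pow_eq_one (zetaC_pow n hn) hn
  rw [Complex.inv_eq_conj h, Complex.add_conj]
  rfl

theorem exists_ringHom_real {n : ℕ} (hn : n ≠ 0) {E : IntermediateField ℚ ℂ}
    (hE : E ≤ realCyclo n) : Nonempty (E →+* ℝ) := by
  have hr (x : E) : ((x : ℂ)).im = 0 := by
    obtain ⟨r, hr⟩ := realCyclo_le_fieldRange n hn (hE x.2)
    rw [← hr]
    exact Complex.ofReal_im r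
  exact ⟨{
    toFun x := (x : ℂ).re
    map_one' := Complex.one_re
    map_zero' := Complex.zero_re
    map_add' x y := Complex.add_re x y
    map_mul' x y := by simp [hr] }⟩

theorem exists_classGroup_hom_not_dvd_index {n : ℕ} (hn : n ≠ 0) (K : IntermediateField ℚ ℂ)
    [FiniteDimensional ℚ K] (hK : K ≤ realCyclo n) (hK2 : finrank ℚ K = 2) {ℓ : ℕ}
    (hℓ : ℓ.Prime) (hℓ2 : Odd ℓ) :
    ∃ f : ClassGroup (𝓞 (realCyclo n)) →* ClassGroup (𝓞 K), ¬ ℓ ∣ f.range.index := by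
  have : NeZero n := ⟨hn⟩
  have hL : IsCyclotomicExtension {n} ℚ ℚ⟮zetaC n⟯ := by
    change IsCyclotomicExtension {n} ℚ ℚ⟮zetaC n⟯.toSubalgebra
    rw [adjoin_simple_toSubalgebra_of_isAlgebraic
      (isIntegral_of_pow_eq_one hn (zetaC_pow n hn)).isAlgebraic]
    exact (isPrimitiveRoot_zetaC hn).adjoin_isCyclotomicExtension ℚ
  have hLf : FiniteDimensional ℚ ℚ⟮zetaC n⟯ := IsCyclotomicExtension.finiteDimensional {n} ℚ _
  have hHL := realCyclo_le_adjoin_zetaC n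
  obtain ⟨σ⟩ := exists_ringHom_real hn hK
  let : Algebra K (realCyclo n) := (inclusion hK).toRingHom.toAlgebra
  let : Algebra (realCyclo n) ℚ⟮zetaC n⟯ := (inclusion hHL).toRingHom.toAlgebra
  let : Algebra K ℚ⟮zetaC n⟯ := (inclusion (hK.trans hHL)).toRingHom.toAlgebra
  have : IsScalarTower K (realCyclo n) ℚ⟮zetaC n⟯ := IsScalarTower.of_algebraMap_eq fun _ ↦ rfl
  exact ⟨_, not_dvd_index_range_classGroupNorm n K (realCyclo n) ℚ⟮zetaC n⟯ hK2 σ hℓ hℓ2⟩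

end RealCyclo

/-- Theorem 1.2 of the paper. -/
theorem statement_0
    (n : ℕ) (hn : 0 < n)
    (ℓ : ℕ) (hℓ : ℓ.Prime) (hℓodd : Odd ℓ)
    (q : ℕ) (hq : q.Prime) (hqn : q ∣ n) (hqℓ : q ≡ 1 [MOD ℓ])
    (m : ℕ) (hm : 1 ≤ m)
    (K₂ : IntermediateField ℚ ℂ) [FiniteDimensional ℚ K₂]
    (hK₂H : K₂ ≤ realCyclo n) (hK₂deg : Module.finrank ℚ K₂ = 2)
    (hH : pCard (ClassGroup (𝓞 (realCyclo n))) ℓ hℓ = ℓ ^ m)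
    (hK₂cl : pCard (ClassGroup (𝓞 K₂)) ℓ hℓ = ℓ ^ (m - 1))
    (hker : ∀ (F K : IntermediateField ℚ ℂ) [FiniteDimensional ℚ F] [FiniteDimensional ℚ K]
      (hFK : F ≤ K), K ≤ realCyclo n → K₂ ≤ F →
      Module.finrank ℚ K = ℓ * Module.finrank ℚ F →
      pCard (ClassGroup (𝓞 F)) ℓ hℓ = ℓ ^ (m - 1) →
      pCard (ClassGroup (𝓞 K)) ℓ hℓ = ℓ ^ m →
      ∀ t : ClassGroup (𝓞 F) →* ClassGroup (𝓞 K), IsClassGroupExtHom hFK t →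
        (Subsingleton ↥(pPart ↥t.ker ℓ hℓ) ∨ ∃ r : ℕ, 0 < r ∧
          Nonempty (↥(pPart ↥t.ker ℓ hℓ) ≃* Multiplicative (Fin r → ZMod ℓ)))) :
    pRank (ClassGroup (𝓞 K₂)) ℓ hℓ ≤ pRank (ClassGroup (𝓞 (realCyclo n))) ℓ hℓ ∧
      pRank (ClassGroup (𝓞 (realCyclo n))) ℓ hℓ ≤ 1 + pRank (ClassGroup (𝓞 K₂)) ℓ hℓ := by
  obtain ⟨f, hf⟩ := exists_classGroup_hom_not_dvd_index hn.ne' K₂ hK₂H hK₂deg hℓ hℓodd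
  exact pRank_le_and_le f hℓ hm hH hK₂cl hf

end PaperStmt
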